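/- Let R be a seminormal commutative integral domain. The following are equivalent: (a) every ideal of R is 2-generated; (b) R is a divisorial Mori domain; (c) R is a finitely stable Mori domain. -/

import Mathlib

noncomputable section

open scoped nonZeroDivisors Pointwise

set_option synthInstance.maxHeartbeats 1000000
set_option maxHeartbeats 1000000

/-- For a nonzero ideal `I` of a domain `R`, viewed as a fractional ideal `J` of the quotient
field, the endomorphism ring `(I : I)` is `J / J` and `{z ∈ K | zI ⊆ (I : I)}` is `J / J / J`.
The ideal `I` is *stable* if it is invertible as an ideal of `(I : I)`, i.e.
`I * ((I:I) : I) = (I:I)`. -/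
def Ideal.IsStableIdeal {R : Type*} [CommRing R] [IsDomain R] (I : Ideal R) : Prop :=
  (I : FractionalIdeal R⁰ (FractionRing R)) *
      ((I : FractionalIdeal R⁰ (FractionRing R)) / (I : FractionalIdeal R⁰ (FractionRing R)) /
        (I : FractionalIdeal R⁰ (FractionRing R))) =
    (I : FractionalIdeal R⁰ (FractionRing R)) / (I : FractionalIdeal R⁰ (FractionRing R))

/-- A domain is *stable* if every nonzero ideal is stable. -/
def StableRing (R : Type*) [CommRing R] [IsDomain R] : Prop :=
  ∀ I : Ideal R, I ≠ ⊥ → I.IsStableIdeal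

/-- A domain is *finitely stable* if every nonzero finitely generated ideal is stable. -/
def FinitelyStableRing (R : Type*) [CommRing R] [IsDomain R] : Prop :=
  ∀ I : Ideal R, I ≠ ⊥ → I.FG → I.IsStableIdeal

/-- An ideal `I` is *divisorial* if `I_v = (I⁻¹)⁻¹ = I`; in terms of fractional ideals,
`1 / (1 / I) = I`. -/
def Ideal.IsDivisorial {R : Type*} [CommRing R] [IsDomain R] (I : Ideal R) : Prop :=
  1 / (1 / (I : FractionalIdeal R⁰ (FractionRing R))) = (I : FractionalIdeal R⁰ (FractionRing R))

/-- A domain is a *Mori domain* if it satisfies the ascending chain condition on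
divisorial ideals. -/
def MoriRing (R : Type*) [CommRing R] [IsDomain R] : Prop :=
  ∀ f : ℕ →o Ideal R, (∀ n, (f n).IsDivisorial) → ∃ n, ∀ m, n ≤ m → f m = f n

/-- A domain is *divisorial* if every nonzero ideal is divisorial. -/
def DivisorialRing (R : Type*) [CommRing R] [IsDomain R] : Prop :=
  ∀ I : Ideal R, I ≠ ⊥ → I.IsDivisorial

/-- An ideal is *2-generated* if it is generated by (at most) two elements. -/
def Ideal.TwoGenerated {R : Type*} [CommRing R] (I : Ideal R) : Prop :=
  ∃ a b : R, I = Ideal.span {a, b}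

/-- A domain is *seminormal* if every element `x` of the quotient field with `x² ∈ R` and
`x³ ∈ R` lies in `R`. -/
def SeminormalRing (R : Type*) [CommRing R] [IsDomain R] : Prop :=
  ∀ x : FractionRing R, x ^ 2 ∈ (algebraMap R (FractionRing R)).range →
    x ^ 3 ∈ (algebraMap R (FractionRing R)).range → x ∈ (algebraMap R (FractionRing R)).range

/-- Field-algebra step: an algebra all of whose small subspaces are stable is at most quadratic. -/
theorem algebra_quadratic {k A : Type*} [Field k] [CommRing A] [Algebra k A] [IsReduced A]
    [Nontrivial A]
    (H : ∀ u v w : A, (∃ p q r : A, p * u + q * v + r * w = 1) →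
      (∀ b : A, (∀ y ∈ [u, v, w], ∃ c₁ c₂ c₃ : k, b * y =
          algebraMap k A c₁ * u + algebraMap k A c₂ * v + algebraMap k A c₃ * w) →
        ∃ c : k, b = algebraMap k A c) →
      ∃ a : A, ∀ y ∈ [u, v, w], ∃ c : k, y = algebraMap k A c * a) :
    ∃ x : A, ∀ y : A, ∃ c d : k, y = algebraMap k A c + algebraMap k A d * x := by
  by_contra hcon
  push Not at hcon
  set φ := algebraMap k A with hφ
  have φinv : ∀ c : k, c ≠ 0 → φ c * φ c⁻¹ = 1 := fun c hc => by
    rw [← map_mul, mul_inv_cancel₀ hc, map_one]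
  have φinj : ∀ c : k, φ c = 0 → c = 0 := fun c hc => by
    by_contra h
    have := φinv c h
    rw [hc, zero_mul] at this
    exact zero_ne_one this
  -- a cyclic module containing 1 consists of scalars
  have cyc : ∀ a x : A, (∃ c : k, (1 : A) = φ c * a) → (∃ c : k, x = φ c * a) → ∃ c : k, x = φ c := by
    rintro a x ⟨c, hc⟩ ⟨d, hd⟩
    have hc0 : c ≠ 0 := by
      rintro rfl
      simp at hc
    refine ⟨d * c⁻¹, ?_⟩
    rw [map_mul]
    linear_combination hd - φ d * a * φinv c hc0 + φ d * φ c⁻¹ * hc.symm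
  -- Step 1
  have quad : ∀ x : A, ∃ c d : k, x ^ 2 = φ c + φ d * x := by
    intro x
    by_contra hx
    push Not at hx
    have hxk : ¬ ∃ c : k, x = φ c := by
      rintro ⟨c, rfl⟩
      exact hx (c ^ 2) 0 (by simp)
    obtain ⟨a, ha⟩ := H 1 x x ⟨1, 0, 0, by ring⟩ (by
      intro b hb
      obtain ⟨c₁, c₂, c₃, h1⟩ := hb 1 (by simp)
      obtain ⟨d₁, d₂, d₃, h2⟩ := hb x (by simp)
      by_cases hq : c₂ + c₃ = 0
      · refine ⟨c₁, ?_⟩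
        have : φ c₂ + φ c₃ = 0 := by rw [← map_add, hq, map_zero]
        linear_combination h1 + x * this
      · exfalso
        have hi := φinv _ hq
        refine hx ((c₂ + c₃)⁻¹ * d₁) ((c₂ + c₃)⁻¹ * (d₂ + d₃ - c₁)) ?_
        simp only [map_mul, map_sub, map_add] at hi ⊢
        linear_combination (-x^2) * hi + φ (c₂ + c₃)⁻¹ * h2 - φ (c₂ + c₃)⁻¹ * x * h1)
    exact hxk (cyc a x (ha 1 (by simp)) (ha x (by simp)))
  -- Step 2
  obtain ⟨x, hx⟩ := hcon 0
  have hxk : ∀ c : k, x ≠ φ c := fun c h => hx c 0 (by simp [h])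
  obtain ⟨y, hy⟩ := hcon x
  have step2 : ∃ z w : A, (∀ c, z ≠ φ c) ∧ (∀ c d, w ≠ φ c + φ d * z) ∧
      ∃ α β γ, z * w = φ α + φ β * z + φ γ * w := by
    by_contra hno
    obtain ⟨a, ha⟩ := H 1 x y ⟨1, 0, 0, by ring⟩ (by
      intro b hb
      obtain ⟨p, q, r, h1⟩ := hb 1 (by simp)
      obtain ⟨d₁, d₂, d₃, h2⟩ := hb x (by simp)
      obtain ⟨e₁, e₂, e₃, h3⟩ := hb y (by simp)
      by_contra hbk
      push Not at hbk
      apply hno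
      by_cases hr : r = 0
      · subst hr
        have hq : q ≠ 0 := by
          rintro rfl
          exact hbk p (by linear_combination h1 + (x + y) * (map_zero φ))
        have hi := φinv _ hq
        have h0 := map_zero φ
        refine ⟨b, y, hbk, ?_, e₁ - e₂ * q⁻¹ * p, e₂ * q⁻¹, e₃, ?_⟩
        · intro c d h
          refine hy (c + d * p) (d * q) ?_
          simp only [map_mul, map_add]
          linear_combination h + φ d * h1 + φ d * y * h0
        · simp only [map_mul, map_sub]
          linear_combination h3 - φ e₂ * x * hi - φ e₂ * φ q⁻¹ * h1 - φ e₂ * φ q⁻¹ * y * h0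
      · have hi := φinv _ hr
        refine ⟨b, x, hbk, ?_, d₁ - d₃ * r⁻¹ * p, d₃ * r⁻¹, d₂ - d₃ * r⁻¹ * q, ?_⟩
        · intro c d h
          by_cases hd : d = 0
          · subst hd
            exact hxk c (by linear_combination h + b * map_zero φ)
          · have hj := φinv _ (mul_ne_zero hd hr)
            refine hy (-(c + d * p) * (d * r)⁻¹) ((1 - d * q) * (d * r)⁻¹) ?_
            simp only [map_mul, map_add, map_sub, map_neg, map_one] at hj ⊢
            linear_combination (-y) * hj + φ (d * r)⁻¹ * (-h - φ d * h1)
        · simp only [map_mul, map_sub]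
          linear_combination h2 - φ d₃ * y * hi - φ d₃ * φ r⁻¹ * h1)
    obtain ⟨c, hc⟩ := cyc a x (ha 1 (by simp)) (ha x (by simp))
    exact hxk c hc
  -- Step 3
  have step3 : ∃ e f : A, e * e = e ∧ f * f = f ∧ e * f = 0 ∧ (∀ c, e ≠ φ c) ∧
      (∀ c d, f ≠ φ c + φ d * e) := by
    obtain ⟨z, w, hz, hw, α, β, γ, hzw⟩ := step2
    obtain ⟨z', hz'⟩ : ∃ z', z' = z - φ γ := ⟨_, rfl⟩
    obtain ⟨w', hw'⟩ : ∃ w', w' = w - φ β := ⟨_, rfl⟩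
    have hzk : ∀ c, z' ≠ φ c := fun c h => hz (c + γ) (by rw [map_add]; linear_combination h - hz')
    have hwk : ∀ c d, w' ≠ φ c + φ d * z' := fun c d h => hw (c + β - d * γ) d (by
      simp only [map_add, map_sub, map_mul]; linear_combination h - hw' + φ d * hz')
    have hc : z' * w' = φ (α + β * γ) := by
      rw [hz', hw']; simp only [map_add, map_mul]; linear_combination hzw
    obtain ⟨c, hcc⟩ : ∃ c, c = α + β * γ := ⟨_, rfl⟩
    rw [← hcc] at hc
    obtain ⟨s, t, hst⟩ := quad z'
    have hs : s = 0 := by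
      by_contra hs
      have hi := φinv _ hs
      refine hwk (-(t * c) * s⁻¹) (c * s⁻¹) ?_
      simp only [map_mul, map_neg]
      linear_combination (-w') * hi + φ s⁻¹ * (z' * hc - w' * hst) - φ s⁻¹ * φ t * hc
    subst hs
    rw [map_zero, zero_add] at hst
    have hc0 : c = 0 := by
      by_contra h
      have hi := φinv _ h
      refine hzk t ?_
      linear_combination (-(z' - φ t)) * hi + φ c⁻¹ * (-z' * hc + w' * hst + φ t * hc)
    subst hc0
    rw [map_zero] at hc
    have ht : t ≠ 0 := by
      rintro rfl
      have : z' ^ 2 = 0 := by rw [hst]; simp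
      exact hzk 0 (by rw [map_zero]; exact pow_eq_zero_iff (two_ne_zero) |>.1 this)
    obtain ⟨s', t', hst'⟩ := quad w'
    have hs' : s' = 0 := by
      by_contra hs
      have hi := φinv _ hs
      refine hzk 0 ?_
      rw [map_zero]
      linear_combination (-z') * hi + φ s'⁻¹ * (- z' * hst' + w' * hc - φ t' * hc)
    subst hs'
    rw [map_zero, zero_add] at hst'
    have ht' : t' ≠ 0 := by
      rintro rfl
      have : w' ^ 2 = 0 := by rw [hst']; simp
      exact hwk 0 0 (by simp only [map_zero, zero_add, zero_mul]; exact pow_eq_zero_iff (two_ne_zero) |>.1 this)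
    have hi := φinv _ ht
    have hi' := φinv _ ht'
    refine ⟨φ t⁻¹ * z', φ t'⁻¹ * w', ?_, ?_, ?_, ?_, ?_⟩
    · linear_combination φ t⁻¹ ^ 2 * hst + φ t⁻¹ * z' * hi
    · linear_combination φ t'⁻¹ ^ 2 * hst' + φ t'⁻¹ * w' * hi'
    · linear_combination φ t⁻¹ * φ t'⁻¹ * hc
    · intro c h
      refine hzk (t * c) ?_
      rw [map_mul]
      linear_combination φ t * h - z' * hi
    · intro c d h
      refine hwk (t' * c) (t' * d * t⁻¹) ?_
      simp only [map_mul]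
      linear_combination φ t' * h - w' * hi'
  obtain ⟨e, f, he, hf, hef, hek, hfk⟩ := step3
  have indep : ∀ p q r : k, φ p + φ q * e + φ r * f = 0 → p = 0 ∧ q = 0 ∧ r = 0 := by
    intro p q r h
    have hr : r = 0 := by
      by_contra hr
      have hi := φinv _ hr
      refine hfk (-p * r⁻¹) (-q * r⁻¹) ?_
      simp only [map_mul, map_neg]
      linear_combination φ r⁻¹ * h - f * hi
    subst hr
    have hq : q = 0 := by
      by_contra hq
      have hi := φinv _ hq
      refine hek (-p * q⁻¹) ?_
      simp only [map_mul, map_neg]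
      linear_combination φ q⁻¹ * h - e * hi - φ q⁻¹ * f * map_zero φ
    subst hq
    refine ⟨φinj p ?_, rfl, rfl⟩
    linear_combination h - (e + f) * map_zero φ
  obtain ⟨a, ha⟩ := H (e + f) (1 - e) 0 ⟨e, 1, 0, by linear_combination he + hef⟩ (by
    intro b hb
    obtain ⟨α, β, r, h1⟩ := hb (e + f) (by simp)
    obtain ⟨γ, δ, r', h2⟩ := hb (1 - e) (by simp)
    have hβ : β = 0 := (indep β (-β) (-β) (by
      simp only [map_neg]
      linear_combination (-(1 - e - f)) * h1 + (φ α - b) * (he + hf + 2 * hef) + φ β * (-he - hef))).1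
    have hγ : γ = 0 := (indep 0 γ 0 (by
      simp only [map_zero]
      linear_combination (-e) * h2 - b * he - φ γ * he + φ δ * he - φ γ * hef)).2.1
    subst hβ
    subst hγ
    rw [map_zero] at h1 h2
    have hαδ : α - δ = 0 := (indep 0 0 (α - δ) (by
      simp only [map_zero, map_sub]
      linear_combination (-f) * h1 + f * h2 + (b - φ α) * (hf + hef) + (b - φ δ) * hef)).2.2
    refine ⟨α, ?_⟩
    have h3 : φ α = φ δ := by rw [sub_eq_zero.1 hαδ]
    linear_combination e * h1 + h2 + (-b + φ α) * (he + hef) - (1 - e) * h3)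
  obtain ⟨r, hr⟩ := ha (e + f) (by simp)
  obtain ⟨s, hs⟩ := ha (1 - e) (by simp)
  obtain ⟨h1, -, h2⟩ := indep (-r) (s + r) s (by
    simp only [map_add, map_neg]
    linear_combination φ s * hr - φ r * hs)
  have hr0 : r = 0 := by simpa using h1
  subst hr0
  rw [map_zero, zero_mul] at hr
  have := (indep 0 1 1 (by simp only [map_zero, map_one]; linear_combination hr)).2.1
  exact one_ne_zero this

section Basics
variable {R K : Type*} [CommRing R] [Field K] [Algebra R K]

theorem sub_div_div (A B C : Submodule R K) : A / B / C = A / (B * C) := by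
  apply le_antisymm
  · rw [Submodule.le_div_iff_mul_le, mul_comm B C, ← mul_assoc]
    exact (mul_le_mul_left (Submodule.le_div_iff_mul_le.1 le_rfl) B).trans
      (Submodule.le_div_iff_mul_le.1 le_rfl)
  · rw [Submodule.le_div_iff_mul_le, Submodule.le_div_iff_mul_le, mul_assoc, mul_comm C B]
    exact Submodule.le_div_iff_mul_le.1 le_rfl

theorem sub_div_mul_le (A B : Submodule R K) : A / B * B ≤ A := Submodule.le_div_iff_mul_le.1 le_rfl

theorem sub_mul_div_le (A B : Submodule R K) : B * (A / B) ≤ A := by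
  rw [mul_comm]; exact sub_div_mul_le A B

theorem sub_div_anti {A B C : Submodule R K} (h : B ≤ C) : A / C ≤ A / B :=
  Submodule.le_div_iff_mul_le.2 ((mul_le_mul_right h _).trans (sub_div_mul_le A C))

theorem sub_div_mono {A B C : Submodule R K} (h : A ≤ B) : A / C ≤ B / C :=
  Submodule.le_div_iff_mul_le.2 ((sub_div_mul_le A C).trans h)

theorem sub_one_mul_mem {N : Submodule R K} {r w : K} (hr : r ∈ (1 : Submodule R K)) (hw : w ∈ N) :
    r * w ∈ N := by
  rw [← one_mul N]; exact Submodule.mul_mem_mul hr hw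

theorem sub_le_vclosure (A : Submodule R K) : A ≤ 1 / (1 / A) :=
  Submodule.le_div_iff_mul_le.2 (sub_mul_div_le _ _)

theorem sub_one_div_vclosure (A : Submodule R K) : 1 / (1 / (1 / A)) = 1 / A :=
  le_antisymm (sub_div_anti (sub_le_vclosure A)) (sub_le_vclosure _)

theorem sub_div_one (A : Submodule R K) : A / 1 = A := by
  apply le_antisymm
  · simpa using sub_div_mul_le A 1
  · rw [Submodule.le_div_iff_mul_le, mul_one]

/-- The image in `K` of a maximal ideal. -/
def IsMaxSub (m : Submodule R K) : Prop :=
  m ≤ 1 ∧ (1 : K) ∉ m ∧ ∀ r ∈ (1 : Submodule R K), r ∉ m → ∃ r' ∈ (1 : Submodule R K), 1 - r' * r ∈ m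

/-- The local condition on a maximal ideal: its endomorphism ring is 2-generated, and it is
invertible there. -/
def GoodSub (m : Submodule R K) : Prop :=
  (∃ x : K, m / m = Submodule.span R {1, x}) ∧ m * (m / m / m) = m / m

/-- Seminormality inside `K`. -/
def SNSub (R K : Type*) [CommRing R] [Field K] [Algebra R K] : Prop :=
  ∀ x : K, x ^ 2 ∈ (1 : Submodule R K) → x ^ 3 ∈ (1 : Submodule R K) → x ∈ (1 : Submodule R K)

variable {m : Submodule R K}

theorem endo_one_mem (m : Submodule R K) : (1 : K) ∈ m / m := Submodule.one_mem_div.2 le_rfl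

theorem endo_one_le (m : Submodule R K) : 1 ≤ m / m := Submodule.one_le.2 (endo_one_mem m)

theorem endo_mul_self (m : Submodule R K) : m / m * m = m :=
  le_antisymm (sub_div_mul_le m m) (by simpa using mul_le_mul_left (endo_one_le m) m)

theorem endo_mul_endo (m : Submodule R K) : m / m * (m / m) = m / m := by
  apply le_antisymm
  · rw [Submodule.le_div_iff_mul_le, mul_assoc, endo_mul_self, endo_mul_self]
  · simpa using mul_le_mul_left (endo_one_le m) (m / m)

theorem endo_module_eq {N : Submodule R K} (h : m / m * N ≤ N) : m / m * N = N :=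
  le_antisymm h (by simpa using mul_le_mul_left (endo_one_le m) N)

theorem le_endo (hm : IsMaxSub m) : m ≤ m / m := hm.1.trans (endo_one_le m)

theorem unit_cancel (hm : IsMaxSub m) {N : Submodule R K} {b w : K} (hb : b ∈ (1 : Submodule R K))
    (hbm : b ∉ m) (hw : b * w ∈ N) (ht : ∀ t ∈ m, t * w ∈ N) : w ∈ N := by
  obtain ⟨r, hr, h⟩ := hm.2.2 b hb hbm
  have : w = r * (b * w) + (1 - r * b) * w := by ring
  rw [this]
  exact N.add_mem (sub_one_mul_mem hr hw) (ht _ h)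

theorem endo_reduced (hsn : SNSub R K) (hm : IsMaxSub m) {y : K} (hy : y ∈ m / m)
    (hy2 : y ^ 2 ∈ m) : y ∈ m := by
  have h1 : y ∈ (1 : Submodule R K) := by
    refine hsn y (hm.1 hy2) (hm.1 ?_)
    have : y ^ 3 = y * y ^ 2 := by ring
    rw [this]
    exact Submodule.mem_div_iff_forall_mul_mem.1 hy _ hy2
  by_contra hym
  exact hym (unit_cancel hm h1 hym (by rwa [← sq]) fun t ht => by
    rw [mul_comm]; exact sub_one_mul_mem h1 ht)

theorem endo_complement (hsn : SNSub R K) (hm : IsMaxSub m) {x : K}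
    (hE : m / m = Submodule.span R {1, x}) {n : Submodule R K} (hmn : m ≤ n) (hn : n ≤ m / m)
    (hEn : m / m * n ≤ n) :
    ∃ n' : Submodule R K, m ≤ n' ∧ n' ≤ m / m ∧ m / m * n' ≤ n' ∧ n * n' = m ∧ (1 : K) ∈ n ⊔ n' := by
  have hmdiv : ∀ {y t : K}, y ∈ m / m → t ∈ m → y * t ∈ m := fun hy ht =>
    Submodule.mem_div_iff_forall_mul_mem.1 hy _ ht
  have hEE : ∀ {y t : K}, y ∈ m / m → t ∈ m / m → y * t ∈ m / m := fun hy ht => by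
    rw [← endo_mul_endo m]; exact Submodule.mul_mem_mul hy ht
  suffices h : ∃ n' : Submodule R K, m ≤ n' ∧ n' ≤ m / m ∧ m / m * n' ≤ n' ∧ n * n' ≤ m ∧
      (1 : K) ∈ n ⊔ n' by
    obtain ⟨n', h1, h2, h3, h4, h5⟩ := h
    refine ⟨n', h1, h2, h3, le_antisymm h4 ?_, h5⟩
    have : m * 1 ≤ m * (n ⊔ n') := mul_le_mul_right (Submodule.one_le.2 h5) m
    rw [mul_one, Submodule.mul_sup] at this
    refine this.trans (sup_le ?_ ?_)
    · rw [mul_comm]; exact mul_le_mul_right h1 n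
    · exact mul_le_mul_left hmn n'
  refine ⟨m / m ⊓ m / n, ?_, inf_le_left, ?_, ?_, ?_⟩
  · refine le_inf (le_endo hm) ?_
    rw [Submodule.le_div_iff_mul_le, mul_comm]
    exact (mul_le_mul_left hn m).trans (endo_mul_self m).le
  · refine le_inf ?_ ?_
    · exact (mul_le_mul_right inf_le_left _).trans (endo_mul_endo m).le
    · rw [Submodule.le_div_iff_mul_le, mul_assoc]
      exact (mul_le_mul_right ((mul_le_mul_left inf_le_right n).trans (sub_div_mul_le m n)) _).trans
        (endo_mul_self m).le
  · exact (mul_le_mul_right inf_le_right _).trans (sub_mul_div_le m n)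
  · by_cases hone : ∃ r ∈ (1 : Submodule R K), r ∉ m ∧ r ∈ n
    · obtain ⟨r, hr, hrm, hrn⟩ := hone
      apply Submodule.mem_sup_left
      exact unit_cancel hm hr hrm (by simpa using hrn) fun t ht => by simpa using hmn ht
    · push Not at hone
      have hRn : ∀ r ∈ (1 : Submodule R K), r ∈ n → r ∈ m := fun r hr hrn => by
        by_contra h; exact hone r hr h hrn
      by_cases hnm : n ≤ m
      · apply Submodule.mem_sup_right
        exact ⟨endo_one_mem m, Submodule.one_mem_div.2 hnm⟩
      obtain ⟨y, hyn, hym⟩ := Set.not_subset.1 hnm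
      have rep : ∀ w ∈ m / m, ∃ a ∈ (1 : Submodule R K), ∃ b ∈ (1 : Submodule R K), w = a + b * x := by
        intro w hw
        rw [hE, Submodule.mem_span_pair] at hw
        obtain ⟨a, b, rfl⟩ := hw
        refine ⟨algebraMap R K a, Submodule.mem_one.2 ⟨a, rfl⟩, algebraMap R K b,
          Submodule.mem_one.2 ⟨b, rfl⟩, ?_⟩
        simp [Algebra.smul_def]
      have hmul : ∀ {a b : K}, a ∈ (1 : Submodule R K) → b ∈ (1 : Submodule R K) →
          a * b ∈ (1 : Submodule R K) := fun ha hb => sub_one_mul_mem ha hb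
      have hxE : x ∈ m / m := by rw [hE]; exact Submodule.subset_span (by simp)
      have hyE := hn hyn
      obtain ⟨a, ha, b, hb, hy⟩ := rep y hyE
      obtain ⟨c, hc, d, hd, hy2⟩ := rep (y * y) (hEE hyE hyE)
      have hbm : b ∉ m := fun h => by
        have hbx : b * x ∈ m := by rw [mul_comm]; exact hmdiv hxE h
        have : y ∈ (1 : Submodule R K) := by
          rw [hy]; exact Submodule.add_mem _ ha (hm.1 hbx)
        exact hym (hRn y this hyn)
      have hz1 : b * (y * y) - d * y ∈ m := by
        refine hRn _ ?_ ?_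
        · have : b * (y * y) - d * y = b * c - d * a := by
            rw [hy2]; linear_combination -d * hy
          rw [this]
          exact Submodule.sub_mem _ (hmul hb hc) (hmul hd ha)
        · refine n.sub_mem (sub_one_mul_mem hb (hEn (Submodule.mul_mem_mul hyE hyn)))
            (sub_one_mul_mem hd hyn)
      have hdm : d ∉ m := fun h => by
        have h1 : d * y ∈ m := by rw [mul_comm]; exact hmdiv hyE h
        have h2 : b * (y * y) ∈ m := by simpa using m.add_mem hz1 h1
        refine hym (endo_reduced hsn hm hyE (unit_cancel hm hb hbm (by rwa [sq]) fun t ht => ?_))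
        rw [mul_comm, sq]; exact hmdiv (hEE hyE hyE) ht
      have hzE : b * y - d ∈ m / m :=
        Submodule.sub_mem _ (sub_one_mul_mem hb hyE) (endo_one_le m hd)
      have hz : b * y - d ∈ m / m ⊓ m / n := by
        refine ⟨hzE, Submodule.mem_div_iff_forall_mul_mem.2 fun w hw => ?_⟩
        obtain ⟨a', ha', b', hb', hw'⟩ := rep w (hn hw)
        have h1 : b * w - b' * y ∈ m := by
          refine hRn _ ?_ (n.sub_mem (sub_one_mul_mem hb hw) (sub_one_mul_mem hb' hyn))
          have : b * w - b' * y = b * a' - b' * a := by rw [hw', hy]; ring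
          rw [this]
          exact Submodule.sub_mem _ (hmul hb ha') (hmul hb' ha)
        refine unit_cancel hm hb hbm (w := (b * y - d) * w) ?_ ?_
        · have : b * ((b * y - d) * w) = (b * y - d) * (b * w - b' * y) +
            b' * (b * (y * y) - d * y) := by ring
          rw [this]
          exact m.add_mem (hmdiv hzE h1) (sub_one_mul_mem hb' hz1)
        · intro t ht
          rw [mul_comm]; exact hmdiv (hEE hzE (hn hw)) ht
      have hdmem : d ∈ n ⊔ (m / m ⊓ m / n) := by
        have : d = b * y - (b * y - d) := by ring
        rw [this]
        exact Submodule.sub_mem _ (Submodule.mem_sup_left (sub_one_mul_mem hb hyn))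
          (Submodule.mem_sup_right hz)
      exact unit_cancel hm hd hdm (by simpa using hdmem) fun t ht => by
        simpa using Submodule.mem_sup_left (hmn ht)

theorem endo_exists_inverse (hsn : SNSub R K) (hm : IsMaxSub m) (hg : GoodSub m)
    {n : Submodule R K} (hmn : m ≤ n) (hn : n ≤ m / m) (hEn : m / m * n ≤ n) :
    ∃ L : Submodule R K, m / m * L = L ∧ n * L = m / m := by
  obtain ⟨⟨x, hE⟩, hinv⟩ := hg
  obtain ⟨n', h1, h2, h3, h4, h5⟩ := endo_complement hsn hm hE hmn hn hEn
  refine ⟨n' * (m / m / m), ?_, ?_⟩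
  · rw [← mul_assoc, endo_module_eq h3]
  · rw [← mul_assoc, h4, hinv]

/-- The endomorphism ring as a subalgebra. -/
def endoAlg (m : Submodule R K) : Subalgebra R K where
  carrier := {x | x ∈ m / m}
  mul_mem' := fun ha hb => (endo_mul_endo m).le (Submodule.mul_mem_mul ha hb)
  add_mem' := fun ha hb => (m / m).add_mem ha hb
  algebraMap_mem' := fun r => endo_one_le m (Submodule.mem_one.2 ⟨r, rfl⟩)

theorem mem_endoAlg {x : K} : x ∈ endoAlg m ↔ x ∈ m / m := Iff.rfl

/-- Nakayama over the endomorphism ring. -/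
theorem endo_nakayama {n J : Submodule R K} (hn : n ≤ m / m) (hEn : m / m * n ≤ n)
    (hJ : J.FG) (hJ0 : J ≠ ⊥) (hEJ : m / m * J ≤ J) (h : J ≤ n * J) : (1 : K) ∈ n := by
  let S := endoAlg m
  let n' : Ideal S :=
    { carrier := {x | (x : K) ∈ n}
      add_mem' := fun ha hb => n.add_mem ha hb
      zero_mem' := n.zero_mem
      smul_mem' := fun c x hx => hEn (Submodule.mul_mem_mul c.2 hx) }
  let J' : Submodule S K :=
    { carrier := {x | x ∈ J}
      add_mem' := fun ha hb => J.add_mem ha hb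
      zero_mem' := J.zero_mem
      smul_mem' := fun c x hx => hEJ (Submodule.mul_mem_mul c.2 hx) }
  have hfg : J'.FG := by
    obtain ⟨s, hs⟩ := hJ
    refine ⟨s, le_antisymm (Submodule.span_le.2 ?_) ?_⟩
    · intro x hx
      change x ∈ J
      rw [← hs]; exact Submodule.subset_span hx
    · intro x hx
      change x ∈ J at hx
      rw [← hs] at hx
      exact Submodule.span_le_restrictScalars R S (s : Set K) hx
  have hle : J' ≤ n' • J' := by
    intro x hx
    have hx' : x ∈ n * J := h hx
    refine Submodule.mul_induction_on hx' ?_ ?_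
    · intro a ha b hb
      have : a * b = (⟨a, hn ha⟩ : S) • b := rfl
      rw [this]
      exact Submodule.smul_mem_smul (show (a : K) ∈ n from ha) hb
    · intro a b ha hb
      exact Submodule.add_mem _ ha hb
  obtain ⟨r, hr1, hr2⟩ := Submodule.exists_sub_one_mem_and_smul_eq_zero_of_fg_of_le_smul n' J' hfg hle
  obtain ⟨j, hj, hj0⟩ := Submodule.exists_mem_ne_zero_of_ne_bot hJ0
  have h0 := hr2 j hj
  have hr0 : (r : K) = 0 := by
    have : (r : K) * j = 0 := h0
    exact (mul_eq_zero.1 this).resolve_right hj0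
  have h1 : (r : K) - 1 ∈ n := hr1
  rw [hr0, zero_sub] at h1
  simpa using n.neg_mem h1

end Basics

section Noeth
variable {R K : Type*} [CommRing R] [Field K] [Algebra R K] {m : Submodule R K}

theorem bounded_induction [IsNoetherianRing R] {E : Submodule R K} (hE : E.FG)
    {P : Submodule R K → Prop}
    (h : ∀ J ≤ E, (∀ J' ≤ E, J < J' → P J') → P J) : ∀ J ≤ E, P J := by
  have : IsNoetherian R E := isNoetherian_of_fg_of_noetherian E hE
  have key : ∀ I : Submodule R E, P (I.map E.subtype) := by
    intro I
    induction I using IsNoetherian.induction with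
    | hgt I ih =>
      refine h _ (Submodule.map_subtype_le E I) ?_
      intro J' hJ' hlt
      have e : (J'.comap E.subtype).map E.subtype = J' := by
        rw [Submodule.map_comap_subtype]; exact inf_eq_right.2 hJ'
      rw [← e]
      apply ih
      rw [← e] at hlt
      exact (Submodule.map_lt_map_iff_of_injective E.injective_subtype).1 hlt
  intro J hJ
  have e : (J.comap E.subtype).map E.subtype = J := by
    rw [Submodule.map_comap_subtype]; exact inf_eq_right.2 hJ
  rw [← e]; exact key _

theorem endo_fg (hg : GoodSub m) : (m / m).FG := by
  obtain ⟨⟨x, hE⟩, -⟩ := hg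
  rw [hE]
  exact Submodule.fg_span (by simp)

theorem endo_loc_inv [IsNoetherianRing R] (hsn : SNSub R K) (hm : IsMaxSub m) (hg : GoodSub m) :
    ∀ J ≤ m / m, J ≠ ⊥ → m / m * J ≤ J → ∃ h ∈ J * (m / m / J), 1 - h ∈ m := by
  refine bounded_induction (endo_fg hg) ?_
  intro J hJE ih hJ0 hEJ
  set E := m / m with hEdef
  have hEE : E * E = E := endo_mul_endo m
  have hJH : J ≤ J * (E / J) := by
    have : (1 : Submodule R K) ≤ E / J := Submodule.one_le.2 (Submodule.one_mem_div.2 hJE)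
    simpa using mul_le_mul_right this J
  have hHE : J * (E / J) ≤ E := sub_mul_div_le _ _
  by_cases h1 : (1 : K) ∈ J * (E / J) ⊔ m
  · obtain ⟨h, hh, t, ht, e⟩ := Submodule.mem_sup.1 h1
    exact ⟨h, hh, by rw [← e]; simpa using ht⟩
  exfalso
  apply h1
  set n := J * (E / J) ⊔ m with hn
  have hnE : n ≤ E := sup_le hHE (le_endo hm)
  have hEn : E * n ≤ n := by
    rw [hn, Submodule.mul_sup, ← mul_assoc]
    exact sup_le_sup (mul_le_mul_left hEJ _) (endo_mul_self m).le
  obtain ⟨L, hEL, hnL⟩ := endo_exists_inverse hsn hm hg (le_sup_right : m ≤ n) hnE hEn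
  replace hEL : E * L = L := hEL
  replace hnL : n * L = E := hnL
  have hJn : J ≤ n := hJH.trans le_sup_left
  have hEleL : E ≤ L := by
    rw [← hnL]
    exact (mul_le_mul_left hnE L).trans hEL.le
  have hJ2E : L * J ≤ E := by
    rw [mul_comm, ← hnL]; exact mul_le_mul_left hJn L
  have hJJ2 : J ≤ L * J := by
    have : (1 : Submodule R K) ≤ L := (endo_one_le m).trans hEleL
    simpa using mul_le_mul_left this J
  have hEJ' : E * J = J := endo_module_eq hEJ
  rcases eq_or_lt_of_le hJJ2 with heq | hlt
  · refine endo_nakayama (m := m) hnE hEn ?_ hJ0 hEJ ?_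
    · have : IsNoetherian R E := isNoetherian_of_fg_of_noetherian E (endo_fg hg)
      have e : (J.comap E.subtype).map E.subtype = J := by
        rw [Submodule.map_comap_subtype]; exact inf_eq_right.2 hJE
      rw [← e]
      exact (IsNoetherian.noetherian _).map _
    · conv_lhs => rw [← hEJ', ← hnL, mul_assoc, ← heq]
  · obtain ⟨h, hh, ht⟩ := ih (L * J) hJ2E hlt (fun h0 => hJ0 (le_bot_iff.1 (h0 ▸ hJJ2)))
      (by rw [← mul_assoc, hEL])
    have hle : L * J * (E / (L * J)) ≤ J * (E / J) := by
      rw [mul_comm L J, mul_assoc]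
      refine mul_le_mul_right ?_ J
      rw [Submodule.le_div_iff_mul_le, mul_assoc, mul_comm (E / (J * L)) J, ← mul_assoc,
        mul_comm L J]
      exact sub_mul_div_le _ _
    have : (1 : K) = h + (1 - h) := by ring
    rw [this]
    exact Submodule.add_mem _ (Submodule.mem_sup_left (hle hh)) (Submodule.mem_sup_right ht)

theorem endo_loc_principal [IsNoetherianRing R] (hsn : SNSub R K) (hm : IsMaxSub m)
    (hg : GoodSub m) {J : Submodule R K} (hEJ : m / m * J ≤ J)
    (hJ : ∃ h ∈ J * (m / m / J), 1 - h ∈ m) :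
    ∃ Y ∈ J, J ≤ Submodule.span R {Y} * (m / m) ⊔ m * J := by
  set E := m / m with hEdef
  have hEE : E * E = E := endo_mul_endo m
  have hmdiv : ∀ {y t : K}, y ∈ E → t ∈ m → y * t ∈ m := fun hy ht =>
    Submodule.mem_div_iff_forall_mul_mem.1 hy _ ht
  have hmdiv' : ∀ {y t : K}, y ∈ m → t ∈ E → y * t ∈ m := fun hy ht => by
    rw [mul_comm]; exact hmdiv ht hy
  have hEmul : ∀ {y t : K}, y ∈ E → t ∈ E → y * t ∈ E := fun hy ht => by
    rw [← hEE]; exact Submodule.mul_mem_mul hy ht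
  have hpair : ∀ {Y g : K}, Y ∈ J → g ∈ E / J → Y * g ∈ E := fun hY hg' => by
    rw [mul_comm]; exact Submodule.mem_div_iff_forall_mul_mem.1 hg' _ hY
  have hgE : ∀ {e g : K}, e ∈ E → g ∈ E / J → e * g ∈ E / J := fun he hg' => by
    refine Submodule.mem_div_iff_forall_mul_mem.2 fun w hw => ?_
    rw [mul_assoc]; exact hEmul he (Submodule.mem_div_iff_forall_mul_mem.1 hg' _ hw)
  have main : ∀ n ≤ E, ∀ Y ∈ J, ∀ g ∈ E / J, n = Submodule.span R {Y * g} * E ⊔ m →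
      ∃ Y ∈ J, ∃ g ∈ E / J, (1 : K) ∈ Submodule.span R {Y * g} * E ⊔ m := by
    refine bounded_induction (endo_fg hg) ?_
    intro n hnE ih Y hY g hgJ hn
    by_cases h1 : (1 : K) ∈ n
    · exact ⟨Y, hY, g, hgJ, hn ▸ h1⟩
    have hmn : m ≤ n := hn ▸ le_sup_right
    have hEn : E * n ≤ n := by
      rw [hn, Submodule.mul_sup]
      refine sup_le_sup ?_ (endo_mul_self m).le
      rw [mul_left_comm, hEE]
    obtain ⟨⟨x, hEx⟩, -⟩ := hg
    obtain ⟨n', hmn', hn'E, hEn', hnn', hone⟩ := endo_complement hsn hm hEx hmn hnE hEn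
    obtain ⟨e, he, e', he', hee⟩ := Submodule.mem_sup.1 hone
    have heE := hnE he
    have heE' := hn'E he'
    have he'm : e' ∉ m := fun h => h1 (hee ▸ n.add_mem he (hmn h))
    have hprod : ∀ {a b : K}, a ∈ n → b ∈ n' → a * b ∈ m := fun ha hb => by
      rw [← hnn']; exact Submodule.mul_mem_mul ha hb
    obtain ⟨Y2, hY2, g2, hg2, hYg2⟩ : ∃ Y2 ∈ J, ∃ g2 ∈ E / J, e' * (Y2 * g2) ∉ m := by
      by_contra hcon
      push Not at hcon
      obtain ⟨h, hh, ht⟩ := hJ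
      have : e' * h ∈ m := by
        refine Submodule.mul_induction_on hh (fun a ha b hb => hcon a ha b hb) ?_
        intro a b ha hb
        rw [mul_add]; exact m.add_mem ha hb
      apply he'm
      have e1 : e' = e' * h + e' * (1 - h) := by ring
      rw [e1]
      exact m.add_mem this (hmdiv heE' ht)
    have hu : Y * g ∈ n := by
      rw [hn]
      apply Submodule.mem_sup_left
      exact Submodule.mem_span_singleton_mul.2 ⟨1, endo_one_mem m, mul_one _⟩
    have hu2E := hpair hY2 hg2
    have hY3 : e * Y + e' * Y2 ∈ J := J.add_mem (hEJ (Submodule.mul_mem_mul heE hY))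
      (hEJ (Submodule.mul_mem_mul heE' hY2))
    have hg3 : e * g + e' * g2 ∈ E / J := Submodule.add_mem _ (hgE heE hgJ) (hgE heE' hg2)
    set Y3 := e * Y + e' * Y2 with hY3d
    set g3 := e * g + e' * g2 with hg3d
    have hee' : e * e' ∈ m := hprod he he'
    have hcross : Y * g2 + Y2 * g ∈ E := E.add_mem (hpair hY hg2) (hpair hY2 hgJ)
    have hYgE := hpair hY hgJ
    have hmem3 : ∀ ε ∈ E, Y3 * g3 * ε ∈ Submodule.span R {Y3 * g3} * E ⊔ m := fun ε hε =>
      Submodule.mem_sup_left (Submodule.mem_span_singleton_mul.2 ⟨ε, hε, rfl⟩)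
    have hn3E : Submodule.span R {Y3 * g3} * E ⊔ m ≤ E := by
      refine sup_le ?_ (le_endo hm)
      intro z hz
      obtain ⟨ε, hε, rfl⟩ := Submodule.mem_span_singleton_mul.1 hz
      exact hEmul (hpair hY3 hg3) hε
    have hu3 : Y * g ∈ Submodule.span R {Y3 * g3} * E ⊔ m := by
      have hd : Y3 * g3 * e - Y * g ∈ m := by
        have h2 : e' = 1 - e := by rw [← hee]; ring
        have : Y3 * g3 * e - Y * g = (e * e') * (e * (Y * g2 + Y2 * g) + e' * (Y2 * g2))
            - (1 + e + e * e) * (Y * g * e') := by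
          rw [hY3d, hg3d, h2]; ring
        rw [this]
        refine m.sub_mem (hmdiv' hee' (E.add_mem (hEmul heE hcross) (hEmul heE' hu2E))) ?_
        exact hmdiv (E.add_mem (E.add_mem (endo_one_mem m) heE) (hEmul heE heE)) (hprod hu he')
      have : Y * g = Y3 * g3 * e - (Y3 * g3 * e - Y * g) := by ring
      rw [this]
      exact Submodule.sub_mem _ (hmem3 e heE) (Submodule.mem_sup_right hd)
    refine ih _ hn3E ?_ Y3 hY3 g3 hg3 rfl
    refine lt_of_le_of_ne ?_ ?_
    · conv_lhs => rw [hn]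
      refine sup_le ?_ le_sup_right
      intro z hz
      obtain ⟨ε, hε, rfl⟩ := Submodule.mem_span_singleton_mul.1 hz
      obtain ⟨a, ha, b, hb, hab⟩ := Submodule.mem_sup.1 hu3
      obtain ⟨δ, hδ, rfl⟩ := Submodule.mem_span_singleton_mul.1 ha
      have e1 : Y * g * ε = Y3 * g3 * (δ * ε) + b * ε := by rw [← hab]; ring
      rw [e1]
      exact Submodule.add_mem _ (hmem3 _ (hEmul hδ hε)) (Submodule.mem_sup_right (hmdiv' hb hε))
    · intro heq
      have hv : Y3 * g3 * e' ∈ n := by rw [heq]; exact hmem3 e' heE'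
      have hd : Y3 * g3 * e' - e' * (Y2 * g2) ∈ m := by
        have h2 : e' = 1 - e := by rw [← hee]; ring
        have : Y3 * g3 * e' - e' * (Y2 * g2) = (e * e') * (e * (Y * g) + e' * (Y * g2 + Y2 * g)
            - (1 + e') * (Y2 * g2)) := by
          rw [hY3d, hg3d, h2]; ring
        rw [this]
        exact hmdiv' hee' (E.sub_mem (E.add_mem (hEmul heE hYgE) (hEmul heE' hcross))
          (hEmul (E.add_mem (endo_one_mem m) heE') hu2E))
      have hwn : e' * (Y2 * g2) ∈ n := by
        have : e' * (Y2 * g2) = Y3 * g3 * e' - (Y3 * g3 * e' - e' * (Y2 * g2)) := by ring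
        rw [this]
        exact n.sub_mem hv (hmn hd)
      have hwn' : e' * (Y2 * g2) ∈ n' := by
        rw [mul_comm]; exact hEn' (Submodule.mul_mem_mul hu2E he')
      exact hYg2 (endo_reduced hsn hm (hn'E hwn') (by rw [sq]; exact hprod hwn hwn'))
  obtain ⟨Y, hY, g, hgJ, h1⟩ := main _ (by
      refine sup_le ?_ (le_endo hm)
      intro z hz
      obtain ⟨ε, hε, rfl⟩ := Submodule.mem_span_singleton_mul.1 hz
      exact hEmul (hpair J.zero_mem (Submodule.zero_mem _)) hε) 0 J.zero_mem 0 (Submodule.zero_mem _) rfl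
  refine ⟨Y, hY, fun w hw => ?_⟩
  obtain ⟨a, ha, t, ht, hat⟩ := Submodule.mem_sup.1 h1
  obtain ⟨ε, hε, rfl⟩ := Submodule.mem_span_singleton_mul.1 ha
  have : w = Y * (g * w * ε) + t * w := by linear_combination (-w) * hat
  rw [this]
  refine Submodule.add_mem _ (Submodule.mem_sup_left (Submodule.mem_span_singleton_mul.2
    ⟨_, hEmul (Submodule.mem_div_iff_forall_mul_mem.1 hgJ _ hw) hε, rfl⟩))
    (Submodule.mem_sup_right (Submodule.mul_mem_mul ht hw))

theorem plane_dichotomy (hm : IsMaxSub m) {I J : Submodule R K} {u v : K} (hJI : m * J ≤ I)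
    (hIJ : I ≤ J) (hu : u ∈ J) (hv : v ∈ J) (hJ : J ≤ Submodule.span R {u, v} ⊔ m * J) :
    I = J ∨ ∃ a ∈ I, I ≤ Submodule.span R {a} ⊔ m * J := by
  by_contra hcon
  push Not at hcon
  obtain ⟨hne, hno⟩ := hcon
  have rep : ∀ w ∈ J, ∃ p ∈ (1 : Submodule R K), ∃ q ∈ (1 : Submodule R K),
      w - (p * u + q * v) ∈ m * J := by
    intro w hw
    obtain ⟨a, ha, t, ht, rfl⟩ := Submodule.mem_sup.1 (hJ hw)
    obtain ⟨p, q, rfl⟩ := Submodule.mem_span_pair.1 ha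
    refine ⟨algebraMap R K p, Submodule.mem_one.2 ⟨p, rfl⟩, algebraMap R K q,
      Submodule.mem_one.2 ⟨q, rfl⟩, ?_⟩
    simpa [Algebra.smul_def] using ht
  have hspan : ∀ {r a : K}, r ∈ (1 : Submodule R K) → r * a ∈ Submodule.span R {a} ⊔ m * J :=
    fun {r a} hr => Submodule.mem_sup_left (sub_one_mul_mem hr (Submodule.mem_span_singleton_self a))
  have hI0 : ∃ a ∈ I, a ∉ m * J := by
    by_contra h
    push Not at h
    exact hno 0 I.zero_mem (fun w hw => Submodule.mem_sup_right (h w hw))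
  obtain ⟨a, haI, ham⟩ := hI0
  obtain ⟨b, hbI, hbm⟩ := Set.not_subset.1 (hno a haI)
  obtain ⟨p, hp, q, hq, ha⟩ := rep a (hIJ haI)
  obtain ⟨p', hp', q', hq', hb⟩ := rep b (hIJ hbI)
  have hR : ∀ {r t : K}, r ∈ (1 : Submodule R K) → t ∈ m * J → r * t ∈ m * J :=
    fun hr ht => sub_one_mul_mem hr ht
  have hmul : ∀ {a b : K}, a ∈ (1 : Submodule R K) → b ∈ (1 : Submodule R K) →
          a * b ∈ (1 : Submodule R K) := fun ha hb => sub_one_mul_mem ha hb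
  have hdm : p * q' - p' * q ∉ m := by
    intro hd
    have hdu : ∀ {w : K}, w ∈ J → (p * q' - p' * q) * w ∈ m * J := fun hw =>
      Submodule.mul_mem_mul hd hw
    by_cases hpm : p ∈ m
    · have hqm : q ∉ m := fun hqm => by
        apply ham
        have : a = (a - (p * u + q * v)) + (p * u + q * v) := by ring
        rw [this]
        exact Submodule.add_mem _ ha (Submodule.add_mem _ (Submodule.mul_mem_mul hpm hu)
          (Submodule.mul_mem_mul hqm hv))
      apply hbm
      refine unit_cancel hm hq hqm (N := Submodule.span R {a} ⊔ m * J) ?_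
        fun t ht => Submodule.mem_sup_right (Submodule.mul_mem_mul ht (hIJ hbI))
      have : q * b = q' * a + (q * (b - (p' * u + q' * v)) - q' * (a - (p * u + q * v))
        - (p * q' - p' * q) * u) := by ring
      rw [this]
      exact Submodule.add_mem _ (hspan hq') (Submodule.mem_sup_right
        (Submodule.sub_mem _ (Submodule.sub_mem _ (hR hq hb) (hR hq' ha)) (hdu hu)))
    · apply hbm
      refine unit_cancel hm hp hpm (N := Submodule.span R {a} ⊔ m * J) ?_
        fun t ht => Submodule.mem_sup_right (Submodule.mul_mem_mul ht (hIJ hbI))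
      have : p * b = p' * a + (p * (b - (p' * u + q' * v)) - p' * (a - (p * u + q * v))
        + (p * q' - p' * q) * v) := by ring
      rw [this]
      exact Submodule.add_mem _ (hspan hp') (Submodule.mem_sup_right
        (Submodule.add_mem _ (Submodule.sub_mem _ (hR hp hb) (hR hp' ha)) (hdu hv)))
  have hdR : p * q' - p' * q ∈ (1 : Submodule R K) := Submodule.sub_mem _ (hmul hp hq') (hmul hp' hq)
  have huI : u ∈ I := by
    refine unit_cancel hm hdR hdm ?_ fun t ht => hJI (Submodule.mul_mem_mul ht hu)
    have : (p * q' - p' * q) * u = q' * a - q * b - (q' * (a - (p * u + q * v))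
      - q * (b - (p' * u + q' * v))) := by ring
    rw [this]
    exact I.sub_mem (I.sub_mem (sub_one_mul_mem hq' haI) (sub_one_mul_mem hq hbI))
      (hJI (Submodule.sub_mem _ (hR hq' ha) (hR hq hb)))
  have hvI : v ∈ I := by
    refine unit_cancel hm hdR hdm ?_ fun t ht => hJI (Submodule.mul_mem_mul ht hv)
    have : (p * q' - p' * q) * v = p * b - p' * a - (p * (b - (p' * u + q' * v))
      - p' * (a - (p * u + q * v))) := by ring
    rw [this]
    exact I.sub_mem (I.sub_mem (sub_one_mul_mem hp hbI) (sub_one_mul_mem hp' haI))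
      (hJI (Submodule.sub_mem _ (hR hp hb) (hR hp' ha)))
  apply hne
  refine le_antisymm hIJ (hJ.trans (sup_le ?_ hJI))
  rw [Submodule.span_le]
  rintro z (rfl | rfl)
  · exact huI
  · exact hvI

theorem local_dichotomy [IsNoetherianRing R] (hsn : SNSub R K) (hm : IsMaxSub m) (hg : GoodSub m)
    {I : Submodule R K} (hI0 : I ≠ ⊥) (hI1 : I ≤ 1) :
    (m / m * I = I ∧ (∃ u ∈ I, ∃ v ∈ I, I ≤ Submodule.span R {u, v} ⊔ m * I) ∧
      ∃ h ∈ I * (m / m / I), 1 - h ∈ m) ∨ ∃ a ∈ I, I ≤ Submodule.span R {a} ⊔ m * I := by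
  have hIJ : I ≤ m / m * I := by simpa using mul_le_mul_left (endo_one_le m) I
  have hmJ : m * (m / m * I) = m * I := by rw [← mul_assoc, mul_comm m, endo_mul_self]
  have hJE : m / m * I ≤ m / m := by simpa using mul_le_mul_right hI1 (m / m)
  have hEJ : m / m * (m / m * I) ≤ m / m * I := by rw [← mul_assoc, endo_mul_endo]
  have hinv := endo_loc_inv hsn hm hg _ hJE (fun h => hI0 (le_bot_iff.1 (h ▸ hIJ))) hEJ
  obtain ⟨Y, hY, hJY⟩ := endo_loc_principal hsn hm hg hEJ hinv
  obtain ⟨x, hEx⟩ := hg.1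
  have hxE : x ∈ m / m := by rw [hEx]; exact Submodule.subset_span (by simp)
  have hYx : Y * x ∈ m / m * I := by rw [mul_comm Y x]; exact hEJ (Submodule.mul_mem_mul hxE hY)
  have hspan : Submodule.span R {Y} * (m / m) ≤ Submodule.span R {Y, Y * x} := by
    rw [hEx, Submodule.span_mul_span]
    apply Submodule.span_mono
    rintro _ ⟨a, ha, b, hb, rfl⟩
    rw [Set.mem_singleton_iff.1 ha]
    rcases hb with rfl | rfl
    · simp
    · simp
  have hJ2 : m / m * I ≤ Submodule.span R {Y, Y * x} ⊔ m * (m / m * I) :=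
    hJY.trans (sup_le_sup_right hspan _)
  have hmI : m * I ≤ I := by simpa using mul_le_mul_left hm.1 I
  rcases plane_dichotomy hm (hmJ.le.trans hmI) hIJ hY hYx hJ2 with h | ⟨a, ha, h⟩
  · left
    rw [← h] at hinv hY hYx hJ2
    exact ⟨h.symm, ⟨Y, hY, _, hYx, hJ2⟩, hinv⟩
  · right
    rw [hmJ] at h
    exact ⟨a, ha, h⟩
end Noeth

section Dim
variable {R K : Type*} [CommRing R] [Field K] [Algebra R K] {m : Submodule R K}

/-- The Mori condition expressed with submodules of `K`. -/
def MoriSub (R K : Type*) [CommRing R] [Field K] [Algebra R K] : Prop :=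
  ∀ g : ℕ → Submodule R K, Monotone g → (∀ n, g n ≤ 1) → (∀ n, g n ≠ ⊥) →
    (∀ n, 1 / (1 / g n) = g n) → ∃ n, ∀ k, n ≤ k → g k = g n

/-- Prime ideals, seen inside `K`. -/
def IsPrimeSub (P : Submodule R K) : Prop :=
  P ≤ 1 ∧ ∀ a ∈ (1 : Submodule R K), ∀ b ∈ (1 : Submodule R K), a * b ∈ P → a ∈ P ∨ b ∈ P

theorem max_le_or {I : Submodule R K} (hm : IsMaxSub m) (hI : I ≤ 1) (hmI : m ≤ I) :
    I = m ∨ I = 1 := by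
  by_cases h : I ≤ m
  · exact Or.inl (le_antisymm h hmI)
  · right
    obtain ⟨r, hr, hrm⟩ := SetLike.not_le_iff_exists.1 h
    obtain ⟨r', hr', h1⟩ := hm.2.2 r (hI hr) hrm
    refine le_antisymm hI (Submodule.one_le.2 ?_)
    have : (1 : K) = (1 - r' * r) + r' * r := by ring
    rw [this]
    exact I.add_mem (hmI h1) (sub_one_mul_mem hr' hr)

theorem max_mul_inv (hm : IsMaxSub m) :
    (m * (1 / m) = m ∧ m / m = 1 / m) ∨ (m * (1 / m) = 1 ∧ m / m = 1) := by
  have h1 : m ≤ m * (1 / m) := by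
    have : (1 : Submodule R K) ≤ 1 / m := Submodule.one_le.2 (Submodule.one_mem_div.2 hm.1)
    simpa using mul_le_mul_right this m
  rcases max_le_or hm (sub_mul_div_le 1 m) h1 with h | h
  · left
    refine ⟨h, le_antisymm (sub_div_mono hm.1) ?_⟩
    rw [Submodule.le_div_iff_mul_le, mul_comm, h]
  · right
    refine ⟨h, le_antisymm ?_ (endo_one_le m)⟩
    calc m / m = m / m * (m * (1 / m)) := by rw [h, mul_one]
      _ = m * (1 / m) := by rw [← mul_assoc, endo_mul_self]
      _ ≤ 1 := h.le

theorem endo_eq_one_div (hm : IsMaxSub m) : ∃ C : Submodule R K, m / m = 1 / C := by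
  rcases max_mul_inv hm with h | h
  · exact ⟨m, h.2⟩
  · exact ⟨1, by rw [h.2, sub_div_one]⟩

theorem good_of_inv (hm : IsMaxSub m) (h : m * (1 / m) = 1) : GoodSub m := by
  have hE : m / m = 1 := by
    rcases max_mul_inv hm with h' | h'
    · exact absurd (Submodule.one_le.1 (h'.1 ▸ h.ge)) hm.2.1
    · exact h'.2
  refine ⟨⟨0, ?_⟩, ?_⟩
  · rw [hE, Submodule.one_eq_span, Submodule.span_insert, Submodule.span_singleton_eq_bot.2 rfl,
      sup_bot_eq]
  · rw [hE, h]

theorem span_inv_mul {p : K} (hp : p ≠ 0) :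
    Submodule.span R {p⁻¹} * Submodule.span R {p} = 1 := by
  rw [Submodule.span_mul_span, Set.singleton_mul_singleton, inv_mul_cancel₀ hp,
    Submodule.one_eq_span]

theorem span_mul_one_div {p : K} (hp : p ≠ 0) (A D : Submodule R K) :
    Submodule.span R {p} * (A / D) = A / (Submodule.span R {p⁻¹} * D) := by
  have h := span_inv_mul (R := R) hp
  apply le_antisymm
  · rw [Submodule.le_div_iff_mul_le]
    calc _ = (Submodule.span R {p⁻¹} * Submodule.span R {p}) * (A / D * D) := by ring
      _ ≤ A := by rw [h, one_mul]; exact sub_div_mul_le _ _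
  · calc A / (Submodule.span R {p⁻¹} * D)
        = Submodule.span R {p} * (Submodule.span R {p⁻¹} * (A / (Submodule.span R {p⁻¹} * D))) := by
          rw [← mul_assoc, mul_comm (Submodule.span R {p}), h, one_mul]
      _ ≤ _ := by
          refine mul_le_mul_right ?_ _
          rw [Submodule.le_div_iff_mul_le]
          calc _ = A / (Submodule.span R {p⁻¹} * D) * (Submodule.span R {p⁻¹} * D) := by ring
            _ ≤ A := sub_div_mul_le _ _

theorem dim_one (hmori : MoriSub R K) (hsn : SNSub R K) (hm : IsMaxSub m) (hg : GoodSub m)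
    {P : Submodule R K} (hP : IsPrimeSub P) (hP0 : P ≠ ⊥) (hPm : P ≤ m) : P = m := by
  by_contra hne
  have hnle : ¬ m ≤ P := fun h => hne (le_antisymm hPm h)
  obtain ⟨s, hs, hsP⟩ := SetLike.not_le_iff_exists.1 hnle
  obtain ⟨C, hC⟩ := endo_eq_one_div hm
  have hinv := hg.2
  set E := m / m with hEdef
  have hEE : E * E = E := endo_mul_endo m
  have hmdiv : ∀ {y t : K}, y ∈ E → t ∈ m → y * t ∈ m := fun hy ht =>
    Submodule.mem_div_iff_forall_mul_mem.1 hy _ ht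
  have cancel : ∀ {q : K}, q ∈ (1 : Submodule R K) → s * q ∈ P → q ∈ P := fun hq h =>
    (hP.2 _ (hm.1 hs) _ hq h).resolve_left hsP
  have hEP : ∀ {y p : K}, y ∈ E → p ∈ P → y * p ∈ P := by
    intro y p hy hp
    refine cancel (hm.1 (hmdiv hy (hPm hp))) ?_
    have : s * (y * p) = (y * s) * p := by ring
    rw [this]
    exact sub_one_mul_mem (hm.1 (hmdiv hy hs)) hp
  let Q : Submodule R K := E ⊓ (P / m)
  have hQ1 : ∀ {q : K}, q ∈ Q → q ∈ (1 : Submodule R K) → q ∈ P := by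
    intro q hq h1
    refine cancel h1 ?_
    rw [mul_comm]
    exact Submodule.mem_div_iff_forall_mul_mem.1 hq.2 _ hs
  have hEQ : ∀ {y q : K}, y ∈ E → q ∈ Q → y * q ∈ Q := by
    intro y q hy hq
    refine ⟨hEE.le (Submodule.mul_mem_mul hy hq.1), Submodule.mem_div_iff_forall_mul_mem.2 ?_⟩
    intro t ht
    have : y * q * t = q * (y * t) := by ring
    rw [this]
    exact Submodule.mem_div_iff_forall_mul_mem.1 hq.2 _ (hmdiv hy ht)
  have hmQ : m * Q = P := by
    apply le_antisymm
    · rw [mul_comm]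
      exact Submodule.le_div_iff_mul_le.1 inf_le_right
    · calc P ≤ E * P := by simpa using mul_le_mul_left (endo_one_le m) P
        _ = m * (E / m * P) := by rw [← mul_assoc, hinv]
        _ ≤ m * Q := by
          refine mul_le_mul_right (Submodule.mul_le.2 ?_) _
          intro z hz p hp
          rw [Submodule.mem_div_iff_forall_mul_mem] at hz
          refine ⟨hz p (hPm hp), Submodule.mem_div_iff_forall_mul_mem.2 ?_⟩
          intro t ht
          have : z * p * t = (z * t) * p := by ring
          rw [this]
          exact hEP (hz t ht) hp
  have hnE : Q ⊔ m ≤ E := sup_le inf_le_left (le_endo hm)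
  have hEn : E * (Q ⊔ m) ≤ Q ⊔ m := by
    rw [Submodule.mul_sup]
    refine sup_le_sup (Submodule.mul_le.2 fun y hy q hq => hEQ hy hq) (endo_mul_self m).le
  have hn1 : (1 : K) ∉ Q ⊔ m := by
    intro h
    obtain ⟨q, hq, t, ht, hqt⟩ := Submodule.mem_sup.1 h
    have hq1 : q ∈ (1 : Submodule R K) := by
      have : q = 1 - t := by rw [← hqt]; ring
      rw [this]
      exact Submodule.sub_mem _ (Submodule.one_le.1 le_rfl) (hm.1 ht)
    apply hm.2.1
    rw [← hqt]
    exact m.add_mem (hPm (hQ1 hq hq1)) ht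
  obtain ⟨L, hEL, hnL⟩ := endo_exists_inverse hsn hm hg (le_sup_right : m ≤ Q ⊔ m) hnE hEn
  change E * L = L at hEL
  change (Q ⊔ m) * L = E at hnL
  set n := Q ⊔ m with hn
  have hEleL : E ≤ L := by
    rw [← hnL]; nth_rewrite 2 [← hEL]; exact mul_le_mul_left hnE L
  have hEnn : E * n = n := endo_module_eq hEn
  have hLQ : L * Q ≤ Q := by
    refine Submodule.mul_le.2 fun y hy q hq => ?_
    have hyE : ∀ t ∈ n, y * t ∈ E := fun t ht => by
      rw [mul_comm, ← hnL]; exact Submodule.mul_mem_mul ht hy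
    have h1 := hyE q (Submodule.mem_sup_left hq)
    refine ⟨h1, Submodule.mem_div_iff_forall_mul_mem.2 ?_⟩
    intro t ht
    refine hQ1 ?_ (hm.1 (hmdiv h1 ht))
    have : y * q * t = (y * t) * q := by ring
    rw [this]
    exact hEQ (hyE t (Submodule.mem_sup_right ht)) hq
  have hLP : L * P ≤ P := by
    rw [← hmQ]
    calc L * (m * Q) = m * (L * Q) := by ring
      _ ≤ m * Q := mul_le_mul_right hLQ _
  have hLkP : ∀ k : ℕ, L ^ k * P ≤ P := by
    intro k
    induction k with
    | zero => simp
    | succ k ih =>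
      rw [pow_succ, mul_assoc]
      exact (mul_le_mul_right hLP _).trans ih
  have hELk : ∀ k : ℕ, E * L ^ (k + 1) = L ^ (k + 1) := by
    intro k; rw [pow_succ', ← mul_assoc, hEL]
  have hEk : ∀ k : ℕ, E ^ (k + 1) = E := by
    intro k
    induction k with
    | zero => simp
    | succ k ih => rw [pow_succ, ih, hEE]
  have hnLk : ∀ k : ℕ, n ^ (k + 1) * L ^ (k + 1) = E := by
    intro k; rw [← mul_pow, hnL, hEk]
  have hLk : ∀ k : ℕ, L ^ (k + 1) = 1 / (C * n ^ (k + 1)) := by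
    intro k
    rw [← sub_div_div, ← hC]
    apply le_antisymm
    · rw [Submodule.le_div_iff_mul_le, mul_comm, hnLk]
    · calc E / n ^ (k + 1) ≤ E / n ^ (k + 1) * E := by
            simpa using mul_le_mul_right (endo_one_le m) (E / n ^ (k + 1))
        _ = (E / n ^ (k + 1) * n ^ (k + 1)) * L ^ (k + 1) := by rw [mul_assoc, hnLk]
        _ ≤ E * L ^ (k + 1) := mul_le_mul_left (sub_div_mul_le _ _) _
        _ = L ^ (k + 1) := hELk k
  obtain ⟨p, hp, hp0⟩ := (Submodule.ne_bot_iff _).1 hP0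
  have key : ∃ k, ∀ j, k ≤ j → Submodule.span R {p} * L ^ (j + 1) =
      Submodule.span R {p} * L ^ (k + 1) := by
    refine hmori (fun k => Submodule.span R {p} * L ^ (k + 1)) ?_ ?_ ?_ ?_
    · refine monotone_nat_of_le_succ fun k => mul_le_mul_right ?_ _
      rw [pow_succ L (k + 1)]
      simpa using mul_le_mul_right ((endo_one_le m).trans hEleL) (L ^ (k + 1))
    · intro k
      refine le_trans ?_ ((hLkP (k + 1)).trans hP.1)
      rw [mul_comm]
      refine mul_le_mul_right ?_ _
      simpa using hp
    · intro k h
      have h1 : (1 : K) ∈ L ^ (k + 1) := by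
        have : (1 : Submodule R K) ≤ L ^ (k + 1) := by
          rw [← hELk]
          rw [← one_mul (1 : Submodule R K)]
          refine mul_le_mul' (endo_one_le m) ?_
          exact one_le_pow₀ ((endo_one_le m).trans hEleL)
        exact Submodule.one_le.1 this
      have h2 := Submodule.mul_mem_mul (Submodule.mem_span_singleton_self (R := R) p) h1
      simp only [h, mul_one] at h2
      exact hp0 ((Submodule.mem_bot R).1 h2)
    · intro k
      simp only [hLk, span_mul_one_div hp0, sub_one_div_vclosure]
  obtain ⟨k, hk⟩ := key
  have h := hk (k + 1) (Nat.le_succ k)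
  have h2 : L ^ (k + 1 + 1) = L ^ (k + 1) := by
    have := congrArg (fun X => Submodule.span R {p⁻¹} * X) h
    simpa only [← mul_assoc, span_inv_mul hp0, one_mul] using this
  have h3 : E = n := by
    rw [← hnLk (k + 1), h2, pow_succ' n, mul_assoc, hnLk k, mul_comm, hEnn]
  exact hn1 (h3 ▸ endo_one_mem m)

theorem max_fg_of_good (hg : GoodSub m) : m.FG := by
  have h1 : (1 : K) ∈ m * (m / m / m) := hg.2.ge (endo_one_mem m)
  obtain ⟨T, T', hT, hT', h⟩ := Submodule.mem_span_mul_finite_of_mem_mul h1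
  have hTm : Submodule.span R (T : Set K) ≤ m := Submodule.span_le.2 hT
  have hT'm : Submodule.span R (T' : Set K) ≤ m / m / m := Submodule.span_le.2 hT'
  rw [← Submodule.span_mul_span] at h
  have : m = Submodule.span R (T : Set K) * (m / m) := by
    apply le_antisymm
    · calc m = 1 * m := (one_mul m).symm
        _ ≤ Submodule.span R (T : Set K) * Submodule.span R (T' : Set K) * m :=
          mul_le_mul_left (Submodule.one_le.2 h) m
        _ ≤ Submodule.span R (T : Set K) * (m / m / m) * m :=
          mul_le_mul_left (mul_le_mul_right hT'm _) m
        _ = Submodule.span R (T : Set K) * (m / m / m * m) := mul_assoc _ _ _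
        _ ≤ _ := mul_le_mul_right (sub_div_mul_le _ _) _
    · calc _ ≤ m * (m / m) := mul_le_mul_left hTm _
        _ = m := by rw [mul_comm, endo_mul_self]
  rw [this]
  exact (Submodule.fg_span T.finite_toSet).mul (endo_fg hg)

end Dim

section Coe
set_option linter.unusedSectionVars false
variable {R K : Type*} [CommRing R] [IsDomain R] [Field K] [Algebra R K] [IsFractionRing R K]

open IsLocalization

theorem cs_mem {I : Ideal R} {r : R} : algebraMap R K r ∈ coeSubmodule K I ↔ r ∈ I := by
  rw [mem_coeSubmodule]
  constructor
  · rintro ⟨y, hy, h⟩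
    rwa [← IsFractionRing.injective R K h]
  · exact fun h => ⟨r, h, rfl⟩

theorem cs_le_one (I : Ideal R) : coeSubmodule K I ≤ 1 := by
  rw [← coeSubmodule_top]; exact coeSubmodule_mono K le_top

theorem cs_ne_bot {I : Ideal R} (h : I ≠ ⊥) : coeSubmodule K I ≠ ⊥ := by
  rw [← coeSubmodule_bot K (R := R)]
  exact fun h' => h (IsFractionRing.coeSubmodule_injective R K h')

theorem exists_cs {J : Submodule R K} (h : J ≤ 1) : ∃ I : Ideal R, coeSubmodule K I = J := by
  refine ⟨J.comap (Algebra.linearMap R K), ?_⟩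
  rw [coeSubmodule, Submodule.map_comap_eq, ← Submodule.one_eq_range]
  exact inf_eq_right.2 h

theorem cs_max {M : Ideal R} (hM : M.IsMaximal) : IsMaxSub (coeSubmodule K M) := by
  refine ⟨cs_le_one M, ?_, ?_⟩
  · rw [← map_one (algebraMap R K), cs_mem]
    exact (Ideal.ne_top_iff_one M).1 hM.ne_top
  · intro r hr hrM
    obtain ⟨r, rfl⟩ := Submodule.mem_one.1 hr
    rw [cs_mem] at hrM
    obtain ⟨y, i, hi, h⟩ := hM.exists_inv hrM
    refine ⟨algebraMap R K y, Submodule.mem_one.2 ⟨y, rfl⟩, ?_⟩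
    rw [← map_mul, ← map_one (algebraMap R K), ← map_sub, cs_mem, ← h]
    simpa using hi

theorem cs_prime {P : Ideal R} (hP : P.IsPrime) : IsPrimeSub (coeSubmodule K P) := by
  refine ⟨cs_le_one P, ?_⟩
  intro a ha b hb h
  obtain ⟨a, rfl⟩ := Submodule.mem_one.1 ha
  obtain ⟨b, rfl⟩ := Submodule.mem_one.1 hb
  rw [← map_mul, cs_mem] at h
  rw [cs_mem, cs_mem]
  exact hP.mem_or_mem h

/-- The common core condition. -/
def CoreSub (R K : Type*) [CommRing R] [Field K] [Algebra R K] : Prop :=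
  SNSub R K ∧ MoriSub R K ∧
    ∀ M : Ideal R, M.IsMaximal → M ≠ ⊥ → GoodSub (IsLocalization.coeSubmodule K M)

theorem core_prime_max (h : CoreSub R K) {P : Ideal R} (hP : P.IsPrime) (hP0 : P ≠ ⊥) :
    P.IsMaximal := by
  obtain ⟨M, hM, hPM⟩ := Ideal.exists_le_maximal P hP.ne_top
  have hM0 : M ≠ ⊥ := fun h => hP0 (le_bot_iff.1 (h ▸ hPM))
  have := dim_one h.2.1 h.1 (cs_max hM) (h.2.2 M hM hM0) (cs_prime (K := K) hP) (cs_ne_bot hP0)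
    (coeSubmodule_mono K hPM)
  rw [IsFractionRing.coeSubmodule_injective R K this]
  exact hM

theorem core_noeth (h : CoreSub R K) : IsNoetherianRing R := by
  refine IsNoetherianRing.of_prime_ne_bot fun P hP hP0 => ?_
  have := max_fg_of_good (h.2.2 P (core_prime_max h hP hP0) hP0)
  exact (coeSubmodule_fg K (IsFractionRing.injective R K) P).1 this

theorem sub_nak {M : Ideal R} {N N' : Submodule R K} (hN' : N'.FG)
    (h : N' ≤ N ⊔ coeSubmodule K M * N') :
    ∃ s ∈ coeSubmodule K M, ∀ x ∈ N', (1 - s) * x ∈ N := by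
  obtain ⟨r, hr, h2⟩ := Submodule.exists_sub_one_mem_and_smul_eq_zero_of_fg_of_le_smul M
    (N'.map N.mkQ) (hN'.map _) (by
      rintro _ ⟨x, hx, rfl⟩
      obtain ⟨a, ha, b, hb, rfl⟩ := Submodule.mem_sup.1 (h hx)
      rw [map_add, Submodule.mkQ_apply, Submodule.mkQ_apply,
        (Submodule.Quotient.mk_eq_zero N).2 ha, zero_add]
      rw [← Submodule.map_smul'']
      refine Submodule.mem_map_of_mem (f := N.mkQ) ?_
      clear hx
      refine Submodule.mul_induction_on hb ?_ ?_
      · rintro s ⟨s, hs, rfl⟩ x hx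
        rw [Algebra.linearMap_apply, ← Algebra.smul_def]
        exact Submodule.smul_mem_smul hs hx
      · exact fun x y hx hy => Submodule.add_mem _ hx hy)
  refine ⟨algebraMap R K (1 - r), cs_mem.2 ?_, ?_⟩
  · rw [← neg_sub]; exact M.neg_mem hr
  · intro x hx
    have := h2 _ (Submodule.mem_map_of_mem (f := N.mkQ) hx)
    rw [← map_smul, Submodule.mkQ_apply, Submodule.Quotient.mk_eq_zero] at this
    simpa [Algebra.smul_def] using this

theorem sub_glob {J : Submodule R K}
    (h : ∀ M : Ideal R, M.IsMaximal → ∃ y ∈ J, 1 - y ∈ coeSubmodule K M) : (1 : K) ∈ J := by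
  obtain ⟨I, hI⟩ := exists_cs (inf_le_left : 1 ⊓ J ≤ 1)
  have : I = ⊤ := by
    by_contra hne
    obtain ⟨M, hM, hIM⟩ := Ideal.exists_le_maximal I hne
    obtain ⟨y, hy, hyM⟩ := h M hM
    have h1 : (1 : K) ∈ (1 : Submodule R K) := Submodule.one_le.1 le_rfl
    have hy1 : y ∈ (1 : Submodule R K) := by
      have : y = 1 - (1 - y) := by ring
      rw [this]
      exact Submodule.sub_mem _ h1 (cs_le_one M hyM)
    have hyI : y ∈ coeSubmodule K M := coeSubmodule_mono K hIM (hI.ge ⟨hy1, hy⟩)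
    apply (cs_max (K := K) hM).2.1
    simpa using Submodule.add_mem _ hyM hyI
  rw [this, coeSubmodule_top] at hI
  exact (hI.le (Submodule.one_le.1 le_rfl)).2

theorem core_dich (h : CoreSub R K) {M : Ideal R} (hM : M.IsMaximal) {I : Submodule R K}
    (hI0 : I ≠ ⊥) (hI1 : I ≤ 1) :
    (coeSubmodule K M / coeSubmodule K M * I = I ∧
      (∃ u ∈ I, ∃ v ∈ I, I ≤ Submodule.span R {u, v} ⊔ coeSubmodule K M * I) ∧
      ∃ h ∈ I * (coeSubmodule K M / coeSubmodule K M / I), 1 - h ∈ coeSubmodule K M) ∨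
    ∃ a ∈ I, I ≤ Submodule.span R {a} ⊔ coeSubmodule K M * I := by
  have := core_noeth h
  by_cases hM0 : M = ⊥
  · right
    obtain ⟨J, rfl⟩ := exists_cs hI1
    have hJ0 : J ≠ ⊥ := by rintro rfl; exact hI0 (coeSubmodule_bot K)
    have hJ : J = ⊤ := by
      subst hM0
      exact hM.1.2 J (bot_lt_iff_ne_bot.2 hJ0)
    subst hJ
    rw [coeSubmodule_top]
    refine ⟨1, Submodule.one_le.1 le_rfl, le_sup_of_le_left ?_⟩
    rw [Submodule.one_eq_span]
  · exact local_dichotomy h.1 (cs_max hM) (h.2.2 M hM hM0) hI0 hI1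

end Coe

section Conseq
set_option linter.unusedSectionVars false
variable {R K : Type*} [CommRing R] [IsDomain R] [Field K] [Algebra R K] [IsFractionRing R K]

open IsLocalization

theorem principal_case {M : Ideal R} (hM : M.IsMaximal) {I : Submodule R K} (hI0 : I ≠ ⊥)
    (hfg : I.FG) {a : K} (h : I ≤ Submodule.span R {a} ⊔ coeSubmodule K M * I) :
    a ≠ 0 ∧ ∃ s ∈ coeSubmodule K M, (1 - s) * a⁻¹ ∈ 1 / I := by
  obtain ⟨s, hs, h1⟩ := sub_nak hfg h
  have hs1 : 1 - s ≠ 0 := by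
    intro h0
    apply (cs_max (K := K) hM).2.1
    rwa [sub_eq_zero.1 h0]
  have ha : a ≠ 0 := by
    rintro rfl
    apply hI0
    rw [Submodule.eq_bot_iff]
    intro x hx
    have := h1 x hx
    rw [Submodule.span_zero_singleton, Submodule.mem_bot] at this
    exact (mul_eq_zero.1 this).resolve_left hs1
  refine ⟨ha, s, hs, Submodule.mem_div_iff_forall_mul_mem.2 ?_⟩
  intro x hx
  obtain ⟨r, hr⟩ := Submodule.mem_span_singleton.1 (h1 x hx)
  refine Submodule.mem_one.2 ⟨r, ?_⟩
  rw [Algebra.smul_def] at hr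
  field_simp
  rw [hr]

theorem div_bound {m I : Submodule R K} (hm : IsMaxSub m) {w : K} (hw : w ∈ 1 / (1 / I)) :
    ∀ z ∈ m / m / I, w * z ∈ m / m := by
  have key : m / m = 1 → ∀ z ∈ m / m / I, w * z ∈ m / m := by
    intro hE z hz
    rw [hE] at hz ⊢
    exact Submodule.mem_div_iff_forall_mul_mem.1 hw _ hz
  rcases max_mul_inv hm with ⟨h1, h2⟩ | ⟨h1, h2⟩
  · have hle : m ≤ 1 / (m / m) := by
      rw [Submodule.le_div_iff_mul_le, mul_comm, endo_mul_self]; exact hm.1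
    have hle1 : 1 / (m / m) ≤ 1 := by
      have := sub_div_anti (A := 1) (endo_one_le m)
      rwa [sub_div_one] at this
    rcases max_le_or hm hle1 hle with h3 | h3
    · intro z hz
      rw [Submodule.mem_div_iff_forall_mul_mem] at hw hz ⊢
      intro t ht
      rw [← h3, Submodule.mem_div_iff_forall_mul_mem]
      intro y hy
      have : w * z * t * y = w * (z * (y * t)) := by ring
      rw [this]
      refine hw _ (Submodule.mem_div_iff_forall_mul_mem.2 ?_)
      intro i hi
      have h5 : y * t ∈ m := Submodule.mem_div_iff_forall_mul_mem.1 hy _ ht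
      have : z * (y * t) * i = (z * i) * (y * t) := by ring
      rw [this]
      exact hm.1 (Submodule.mem_div_iff_forall_mul_mem.1 (hz i hi) _ h5)
    · apply key
      refine le_antisymm ?_ (endo_one_le m)
      have := sub_le_vclosure (m / m)
      rwa [h3, sub_div_one] at this
  · exact key h2

theorem core_divisorial (h : CoreSub R K) {I : Submodule R K} (hI0 : I ≠ ⊥) (hI1 : I ≤ 1) :
    1 / (1 / I) = I := by
  have := core_noeth h
  have hfg : I.FG := by
    obtain ⟨J, rfl⟩ := exists_cs hI1
    exact (coeSubmodule_fg K (IsFractionRing.injective R K) J).2 (IsNoetherian.noetherian J)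
  refine le_antisymm ?_ (sub_le_vclosure I)
  intro w hw
  suffices (1 : K) ∈ I / Submodule.span R {w} by
    have := Submodule.mem_div_iff_forall_mul_mem.1 this w (Submodule.mem_span_singleton_self w)
    simpa using this
  have hmem : ∀ y : K, y * w ∈ I → y ∈ I / Submodule.span R {w} := by
    intro y hy
    rw [Submodule.mem_div_iff_forall_mul_mem]
    intro z hz
    obtain ⟨r, rfl⟩ := Submodule.mem_span_singleton.1 hz
    rw [mul_smul_comm]
    exact I.smul_mem _ hy
  refine sub_glob fun M hM => ?_
  rcases core_dich h hM hI0 hI1 with ⟨h1, -, y, hy, hyM⟩ | ⟨a, ha, hI⟩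
  · refine ⟨y, hmem y ?_, hyM⟩
    have hb := div_bound (cs_max (K := K) hM) hw
    rw [mul_comm y w, ← h1, mul_comm _ I]
    clear hyM
    refine Submodule.mul_induction_on hy ?_ ?_
    · intro i hi z hz
      have : w * (i * z) = i * (w * z) := by ring
      rw [this]
      exact Submodule.mul_mem_mul hi (hb z hz)
    · intro x y hx hy
      rw [mul_add]; exact Submodule.add_mem _ hx hy
  · obtain ⟨ha0, s, hs, h2⟩ := principal_case hM hI0 hfg hI
    refine ⟨1 - s, hmem _ ?_, by simpa using hs⟩
    have h3 := Submodule.mem_div_iff_forall_mul_mem.1 hw _ h2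
    have : (1 - s) * w = (w * ((1 - s) * a⁻¹)) * a := by field_simp
    rw [this]
    exact sub_one_mul_mem h3 ha

theorem core_stable (h : CoreSub R K) {I : Submodule R K} (hI0 : I ≠ ⊥) (hI1 : I ≤ 1) :
    I * (I / I / I) = I / I := by
  have := core_noeth h
  have hfg : I.FG := by
    obtain ⟨J, rfl⟩ := exists_cs hI1
    exact (coeSubmodule_fg K (IsFractionRing.injective R K) J).2 (IsNoetherian.noetherian J)
  refine le_antisymm (sub_mul_div_le _ _) ?_
  suffices h1 : (1 : K) ∈ I * (I / I / I) by
    calc I / I = I / I * 1 := (mul_one _).symm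
      _ ≤ I / I * (I * (I / I / I)) := mul_le_mul_right (Submodule.one_le.2 h1) _
      _ = I * (I / I / I) := by rw [← mul_assoc, endo_mul_self]
  refine sub_glob fun M hM => ?_
  rcases core_dich h hM hI0 hI1 with ⟨h1, -, y, hy, hyM⟩ | ⟨a, ha, hI⟩
  · refine ⟨y, ?_, hyM⟩
    refine mul_le_mul_right (sub_div_mono ?_) I hy
    rw [Submodule.le_div_iff_mul_le, h1]
  · obtain ⟨ha0, s, hs, h2⟩ := principal_case hM hI0 hfg hI
    refine ⟨1 - s, ?_, by simpa using hs⟩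
    have : 1 - s = a * ((1 - s) * a⁻¹) := by field_simp
    rw [this]
    exact Submodule.mul_mem_mul ha (sub_div_mono (endo_one_le I) h2)

theorem core_local_gen (h : CoreSub R K) {I : Ideal R} (hI0 : I ≠ ⊥) {M : Ideal R}
    (hM : M.IsMaximal) : ∃ u ∈ I, ∃ v ∈ I, I ≤ Ideal.span {u, v} ⊔ M * I := by
  have key : ∃ u ∈ coeSubmodule K I, ∃ v ∈ coeSubmodule K I,
      coeSubmodule K I ≤ Submodule.span R {u, v} ⊔ coeSubmodule K M * coeSubmodule K I := by
    rcases core_dich h hM (cs_ne_bot hI0) (cs_le_one I) with ⟨-, h1, -⟩ | ⟨a, ha, h1⟩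
    · exact h1
    · exact ⟨a, ha, a, ha, by simpa using h1⟩
  obtain ⟨u, hu, v, hv, h1⟩ := key
  obtain ⟨u, hu, rfl⟩ := hu
  obtain ⟨v, hv, rfl⟩ := hv
  refine ⟨u, hu, v, hv, ?_⟩
  rw [← IsFractionRing.coeSubmodule_le_coeSubmodule (K := K), coeSubmodule_sup, coeSubmodule_span,
    coeSubmodule_mul, Set.image_pair]
  exact h1

end Conseq

section TwoGen
variable {R : Type*} [CommRing R] [IsDomain R]

theorem crt_ideal {S : Set (Ideal R)} (hS : S.Finite) (hmax : ∀ M ∈ S, M.IsMaximal) (I : Ideal R)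
    (w : Ideal R → R) (hw : ∀ M ∈ S, w M ∈ I) : ∃ a ∈ I, ∀ M ∈ S, a - w M ∈ M * I := by
  classical
  have := hS.to_subtype
  have := Fintype.ofFinite S
  have hp : Pairwise (Function.onFun IsCoprime (fun M : S => (M : Ideal R))) := by
    intro M M' hne
    rw [Function.onFun, Ideal.isCoprime_iff_sup_eq]
    exact (hmax M M.2).coprime_of_ne (hmax M' M'.2) (fun h => hne (Subtype.ext h))
  have : ∀ M : S, ∃ r : R, ∀ M' : S, r - (if M' = M then 1 else 0) ∈ (M' : Ideal R) :=
    fun M => Ideal.exists_forall_sub_mem_ideal hp _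
  choose e he using this
  refine ⟨∑ M : S, e M * w M, I.sum_mem fun M _ => I.mul_mem_left _ (hw M M.2), ?_⟩
  intro M hM
  have h1 : ∑ M' : S, e M' * w M' - w M =
      ∑ M' : S, (e M' - (if (⟨M, hM⟩ : S) = M' then 1 else 0)) * w M' := by
    simp [sub_mul, Finset.sum_sub_distrib]
  rw [h1]
  exact Ideal.sum_mem _ fun M' _ => Ideal.mul_mem_mul (he M' ⟨M, hM⟩) (hw M' M'.2)

theorem finite_over [IsNoetherianRing R] (hdim : ∀ P : Ideal R, P.IsPrime → P ≠ ⊥ → P.IsMaximal)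
    {J : Ideal R} (hJ : J ≠ ⊥) : {M : Ideal R | M.IsMaximal ∧ J ≤ M}.Finite := by
  refine (Ideal.finite_minimalPrimes_of_isNoetherianRing R J).subset ?_
  rintro M ⟨hM, hJM⟩
  have := hM.isPrime
  obtain ⟨P, hP, hPM⟩ := Ideal.exists_minimalPrimes_le hJM
  have hP0 : P ≠ ⊥ := fun h => hJ (le_bot_iff.1 (h ▸ hP.1.2))
  have := (hdim P hP.1.1 hP0).eq_of_le hM.ne_top hPM
  rwa [← this]

theorem colon_local {I M : Ideal R} (hM : M.IsMaximal) {a : R}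
    (h : ¬ {r : R | ∀ x ∈ I, r * x ∈ Ideal.span {a}} ⊆ (M : Set R)) :
    I ≤ Ideal.span {a} ⊔ M * I := by
  rw [Set.not_subset] at h
  obtain ⟨r, hr, hrM⟩ := h
  obtain ⟨y, i, hi, h⟩ := hM.exists_inv hrM
  intro x hx
  have : x = y * (r * x) + i * x := by
    rw [← mul_assoc, ← add_mul, h, one_mul]
  rw [this]
  exact Submodule.add_mem_sup (Ideal.mul_mem_left _ _ (hr x hx)) (Ideal.mul_mem_mul hi hx)

theorem two_gen_of_local [IsNoetherianRing R]
    (hdim : ∀ P : Ideal R, P.IsPrime → P ≠ ⊥ → P.IsMaximal) {I : Ideal R}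
    (hloc : ∀ M : Ideal R, M.IsMaximal → ∃ u ∈ I, ∃ v ∈ I, I ≤ Ideal.span {u, v} ⊔ M * I) :
    ∃ a b : R, I = Ideal.span {a, b} := by
  classical
  by_cases hI0 : I = ⊥
  · exact ⟨0, 0, by simp [hI0]⟩
  obtain ⟨a0, ha0, hne⟩ := (Submodule.ne_bot_iff I).1 hI0
  let col : R → Ideal R := fun a => (Ideal.span {a}).colon (I : Set R)
  have hcol : ∀ a r, r ∈ col a ↔ ∀ x ∈ I, r * x ∈ Ideal.span {a} := by
    intro a r
    simp [col, Submodule.mem_colon]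
  have hcolself : ∀ a, a ∈ col a := fun a => (hcol a a).2 fun x _ =>
    Ideal.mul_mem_right _ _ (Ideal.mem_span_singleton_self a)
  have hcol0 : ∀ a, a ≠ 0 → col a ≠ ⊥ := fun a ha h => ha (by
    have := hcolself a
    rwa [h, Ideal.mem_bot] at this)
  have hcl : ∀ a (M : Ideal R), M.IsMaximal → ¬ col a ≤ M → I ≤ Ideal.span {a} ⊔ M * I := by
    intro a M hM h
    refine colon_local hM fun h' => h fun r hr => h' ((hcol a r).1 hr)
  choose! u hu v hv huv using hloc
  have hS0 := finite_over hdim (hcol0 a0 hne)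
  obtain ⟨a, haI, ha⟩ : ∃ a ∈ I, a ≠ 0 ∧ ∀ M : Ideal R, M.IsMaximal → col a0 ≤ M →
      a - u M ∈ M * I := by
    obtain ⟨a, haI, ha⟩ := crt_ideal hS0 (fun M h => h.1) I u (fun M h => hu M h.1)
    by_cases h0 : a = 0
    · refine ⟨a0 * a0, I.mul_mem_left _ ha0, mul_ne_zero hne hne, fun M hM hcM => ?_⟩
      have h1 := ha M ⟨hM, hcM⟩
      rw [h0] at h1
      have : a0 * a0 - u M = a0 * a0 + (0 - u M) := by ring
      rw [this]
      exact Ideal.add_mem _ (Ideal.mul_mem_mul (hcM (hcolself a0)) ha0) h1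
    · exact ⟨a, haI, h0, fun M hM hcM => ha M ⟨hM, hcM⟩⟩
  have hS1 := finite_over hdim (hcol0 a ha.1)
  obtain ⟨b, hbI, hb⟩ := crt_ideal hS1 (fun M h => h.1) I
    (fun M => if col a0 ≤ M then v M else a0) (fun M h => by
      by_cases h' : col a0 ≤ M
      · simpa [h'] using hv M h.1
      · simpa [h'] using ha0)
  have hloc2 : ∀ M : Ideal R, M.IsMaximal → I ≤ Ideal.span {a, b} ⊔ M * I := by
    intro M hM
    have hAa : a ∈ Ideal.span {a, b} ⊔ M * I :=
      Ideal.mem_sup_left (Ideal.subset_span (by simp))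
    have hAb : b ∈ Ideal.span {a, b} ⊔ M * I :=
      Ideal.mem_sup_left (Ideal.subset_span (by simp))
    by_cases h1 : col a ≤ M
    · have hbM := hb M ⟨hM, h1⟩
      by_cases h0 : col a0 ≤ M
      · simp only [h0, if_true] at hbM
        refine (huv M hM).trans (sup_le (Ideal.span_le.2 ?_) le_sup_right)
        have haM := ha.2 M hM h0
        rintro x (rfl | rfl)
        · have : u M = a - (a - u M) := by ring
          rw [this]
          exact Ideal.sub_mem _ hAa (Ideal.mem_sup_right haM)
        · have : v M = b - (b - v M) := by ring
          rw [this]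
          exact Ideal.sub_mem _ hAb (Ideal.mem_sup_right hbM)
      · simp only [h0, if_false] at hbM
        refine (hcl a0 M hM h0).trans (sup_le ?_ le_sup_right)
        rw [Ideal.span_singleton_le_iff_mem]
        have : a0 = b - (b - a0) := by ring
        rw [this]
        exact Ideal.sub_mem _ hAb (Ideal.mem_sup_right hbM)
    · refine (hcl a M hM h1).trans (sup_le ?_ le_sup_right)
      rwa [Ideal.span_singleton_le_iff_mem]
  refine ⟨a, b, le_antisymm ?_ ?_⟩
  · by_contra hnot
    let J : Ideal R := (Ideal.span {a, b}).colon (I : Set R)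
    have hJ : ∀ r, r ∈ J ↔ ∀ x ∈ I, r * x ∈ Ideal.span {a, b} := by
      intro r
      simp [J, Submodule.mem_colon]
    have hJtop : J ≠ ⊤ := by
      intro h
      apply hnot
      intro x hx
      have := (hJ 1).1 (h ▸ Submodule.mem_top) x hx
      simpa using this
    obtain ⟨M, hM, hJM⟩ := Ideal.exists_le_maximal J hJtop
    have h1 := sub_nak (K := FractionRing R) (M := M)
      (N := IsLocalization.coeSubmodule _ (Ideal.span {a, b}))
      (N' := IsLocalization.coeSubmodule _ I) ((IsLocalization.coeSubmodule_fg _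
        (IsFractionRing.injective R _) I).2 (IsNoetherian.noetherian I)) (by
        rw [← IsLocalization.coeSubmodule_mul, ← IsLocalization.coeSubmodule_sup,
          IsFractionRing.coeSubmodule_le_coeSubmodule]
        exact hloc2 M hM)
    obtain ⟨s, ⟨s, hs, rfl⟩, h2⟩ := h1
    have h3 : 1 - s ∈ J := (hJ _).2 fun x hx => by
      have := h2 (algebraMap R _ x) (cs_mem.2 hx)
      rw [Algebra.linearMap_apply, ← map_one (algebraMap R (FractionRing R)), ← map_sub, ← map_mul,
        cs_mem] at this
      exact this
    apply (Ideal.ne_top_iff_one M).1 hM.ne_top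
    simpa using M.add_mem (hJM h3) hs
  · rw [Ideal.span_le]
    rintro x (rfl | rfl)
    · exact haI
    · exact hbI

end TwoGen

section Good
set_option linter.unusedSectionVars false
variable {R K : Type*} [CommRing R] [IsDomain R] [Field K] [Algebra R K] [IsFractionRing R K]

open IsLocalization

theorem inv_of_one_mem {I : Submodule R K} (h1 : (1 : K) ∈ I * (I / I / I)) :
    I * (I / I / I) = I / I := by
  refine le_antisymm (sub_mul_div_le _ _) ?_
  calc I / I = I / I * 1 := (mul_one _).symm
    _ ≤ I / I * (I * (I / I / I)) := mul_le_mul_right (Submodule.one_le.2 h1) _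
    _ = I * (I / I / I) := by rw [← mul_assoc, endo_mul_self]

theorem good_of_divisorial [IsNoetherianRing R] {m : Submodule R K} (hsn : SNSub R K)
    (hm : IsMaxSub m) (hm0 : m ≠ ⊥)
    (hdiv : ∀ J : Submodule R K, J ≠ ⊥ → (∃ c : K, c ≠ 0 ∧ ∀ y ∈ J, c * y ∈ (1 : Submodule R K)) →
      1 / (1 / J) = J) : GoodSub m := by
  rcases max_mul_inv hm with ⟨h1, hE⟩ | ⟨h1, -⟩
  swap
  · exact good_of_inv hm h1
  obtain ⟨c, hc, hc0⟩ := (Submodule.ne_bot_iff _).1 hm0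
  have hbd : ∀ J : Submodule R K, (1 : K) ∈ J → J ≤ m / m → 1 / (1 / J) = J := by
    intro J hJ1 hJ
    refine hdiv J (fun h => one_ne_zero ((Submodule.mem_bot R).1 (h ▸ hJ1))) ⟨c, hc0, ?_⟩
    intro y hy
    rw [mul_comm]
    exact hm.1 (Submodule.mem_div_iff_forall_mul_mem.1 (hJ hy) _ hc)
  have hbd2 : ∀ J : Submodule R K, m ≤ J → J ≤ m / m → 1 / (1 / J) = J := by
    intro J hJ1 hJ
    refine hdiv J (fun h => hm0 (le_bot_iff.1 (h ▸ hJ1))) ⟨c, hc0, ?_⟩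
    intro y hy
    rw [mul_comm]
    exact hm.1 (Submodule.mem_div_iff_forall_mul_mem.1 (hJ hy) _ hc)
  have hmv : 1 / (1 / m) = m := hbd2 m le_rfl (le_endo hm)
  have hEne : ¬ (m / m ≤ 1) := by
    intro h
    have : m / m = 1 := le_antisymm h (endo_one_le m)
    rw [← hE, this, sub_div_one] at hmv
    exact hm.2.1 (hmv ▸ Submodule.one_le.1 le_rfl)
  obtain ⟨x, hx, hx1⟩ := SetLike.not_le_iff_exists.1 hEne
  have hspan : m / m = Submodule.span R {1, x} := by
    have hJE : Submodule.span R {1, x} ≤ m / m := by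
      rw [Submodule.span_le]
      rintro y (rfl | rfl)
      · exact endo_one_mem m
      · exact hx
    have hJ1 : (1 : K) ∈ Submodule.span R {1, x} := Submodule.subset_span (by simp)
    have hJx : x ∈ Submodule.span R {1, x} := Submodule.subset_span (by simp)
    have hv := hbd _ hJ1 hJE
    have ha : m ≤ 1 / Submodule.span R {1, x} := by
      refine le_trans ?_ (sub_div_anti hJE)
      rw [Submodule.le_div_iff_mul_le, mul_comm, endo_mul_self]
      exact hm.1
    have hb : 1 / Submodule.span R {1, x} ≤ 1 := by
      have := sub_div_anti (A := 1) (Submodule.one_le.2 hJ1)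
      rwa [sub_div_one] at this
    rcases max_le_or hm hb ha with h | h
    · rw [← hv, h, hE]
    · rw [h, sub_div_one] at hv
      exact absurd (hv.ge hJx) hx1
  refine ⟨⟨x, hspan⟩, inv_of_one_mem ?_⟩
  have hfgm : m.FG := by
    obtain ⟨J, rfl⟩ := exists_cs hm.1
    exact (coeSubmodule_fg K (IsFractionRing.injective R K) J).2 (IsNoetherian.noetherian J)
  have hmm1 : m * m ≤ m := by simpa using mul_le_mul_left hm.1 m
  have hNv : 1 / (m / m / m) = m * m := by
    rw [hE, sub_div_div]
    refine hdiv _ ?_ ⟨1, one_ne_zero, ?_⟩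
    · intro h
      have := Submodule.mul_mem_mul hc hc
      rw [h, Submodule.mem_bot] at this
      exact mul_ne_zero hc0 hc0 this
    · intro y hy
      rw [one_mul]
      exact hm.1 (hmm1 hy)
  set E := m / m with hEdef
  have hEE : E * E = E := endo_mul_endo m
  set n := m * (E / m) with hn
  set T := (m * m) / m with hT
  have h1n : 1 / n = T := by
    rw [hn, mul_comm, ← sub_div_div, hNv]
  have hTE : T ≤ E := sub_div_mono hmm1
  have hnE : n ≤ E := sub_mul_div_le _ _
  have hEn : E * n ≤ n := by rw [hn, ← mul_assoc, endo_mul_self]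
  have hmn : m ≤ n := by
    have : (1 : Submodule R K) ≤ E / m := Submodule.one_le.2 (Submodule.one_mem_div.2 (le_endo hm))
    simpa using mul_le_mul_right this m
  have hmT : m ≤ T := Submodule.le_div_iff_mul_le.2 le_rfl
  have hTn : T * n ≤ m := by
    rw [← hmv, ← hE, Submodule.le_div_iff_mul_le, mul_assoc, mul_comm n, ← h1n]
    exact (mul_le_mul_right hEn _).trans (sub_div_mul_le _ _)
  have h1T : 1 / T = n := by rw [← h1n]; exact hbd2 n hmn hnE
  have hTnE : T ⊔ n = E := by
    have hv := hbd2 (T ⊔ n) (le_sup_of_le_left hmT) (sup_le hTE hnE)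
    have : 1 / (T ⊔ n) = m := by
      apply le_antisymm
      · intro y hy
        have hyT : y ∈ T := by
          rw [← h1n]; exact sub_div_anti le_sup_right hy
        have hyn : y ∈ n := by
          rw [← h1T]; exact sub_div_anti le_sup_left hy
        refine endo_reduced hsn hm (hTE hyT) ?_
        rw [pow_two]
        exact hTn (Submodule.mul_mem_mul hyT hyn)
      · refine le_trans ?_ (sub_div_anti (sup_le hTE hnE))
        rw [Submodule.le_div_iff_mul_le, mul_comm, endo_mul_self]
        exact hm.1
    rw [← hv, this, hE]
  have hmle : m ≤ n * m := by
    intro t ht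
    have h1' : (1 : K) ∈ T ⊔ n := hTnE ▸ endo_one_mem m
    obtain ⟨y, hy, z, hz, hyz⟩ := Submodule.mem_sup.1 h1'
    have : t = y * t + z * t := by rw [← add_mul, hyz, one_mul]
    rw [this]
    refine Submodule.add_mem _ ?_ (Submodule.mul_mem_mul hz ht)
    exact mul_le_mul_left hmn m (Submodule.mem_div_iff_forall_mul_mem.1 hy t ht)
  exact endo_nakayama hnE hEn hfgm hm0 (endo_mul_self m).le hmle

theorem exchange {m : Submodule R K} (hm : IsMaxSub m) {u v : K}
    (h : m / m = Submodule.span R {u, v}) : ∃ x : K, m / m = Submodule.span R {1, x} := by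
  have hu : u ∈ m / m := h ▸ Submodule.subset_span (by simp)
  have hv : v ∈ m / m := h ▸ Submodule.subset_span (by simp)
  have h1 : (1 : K) ∈ Submodule.span R {u, v} := h ▸ endo_one_mem m
  obtain ⟨p, q, hpq⟩ := Submodule.mem_span_pair.1 h1
  rw [Algebra.smul_def, Algebra.smul_def] at hpq
  have hmem : ∀ r : R, algebraMap R K r ∈ (1 : Submodule R K) := fun r => Submodule.mem_one.2 ⟨r, rfl⟩
  have main : ∀ u v p q : K, u ∈ m / m → v ∈ m / m → p ∈ (1 : Submodule R K) →
      q ∈ (1 : Submodule R K) → p * u + q * v = 1 → p ∉ m →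
      m / m = Submodule.span R {u, v} → m / m = Submodule.span R {1, v} := by
    intro u v p q hu hv hp hq hpq hpm h
    have hle1 : (1 : Submodule R K) ≤ Submodule.span R {1, v} :=
      Submodule.one_le.2 (Submodule.subset_span (by simp))
    have hv1 : v ∈ Submodule.span R {1, v} := Submodule.subset_span (by simp)
    apply le_antisymm
    · rw [h, Submodule.span_le]
      rintro y (rfl | rfl)
      · obtain ⟨p', hp', ht⟩ := hm.2.2 p hp hpm
        have : y = p' - (p' * q) * v + y * (1 - p' * p) := by
          linear_combination p' * hpq
        rw [this]
        refine Submodule.add_mem _ (Submodule.sub_mem _ (hle1 hp') ?_) ?_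
        · rw [mul_assoc]
          exact sub_one_mul_mem hp' (sub_one_mul_mem hq hv1)
        · exact hle1 (hm.1 (Submodule.mem_div_iff_forall_mul_mem.1 hu _ ht))
      · exact hv1
    · rw [Submodule.span_le]
      rintro y (rfl | rfl)
      · exact endo_one_mem m
      · exact hv
  by_cases hp : algebraMap R K p ∈ m
  · by_cases hq : algebraMap R K q ∈ m
    · exfalso
      apply hm.2.1
      rw [← hpq, mul_comm _ u, mul_comm _ v]
      exact m.add_mem (Submodule.mem_div_iff_forall_mul_mem.1 hu _ hp)
        (Submodule.mem_div_iff_forall_mul_mem.1 hv _ hq)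
    · exact ⟨u, main v u _ _ hv hu (hmem q) (hmem p) (by rw [add_comm]; exact hpq) hq
        (by rw [h, Set.pair_comm])⟩
  · exact ⟨v, main u v _ _ hu hv (hmem p) (hmem q) hpq hp h⟩

theorem quad_relation {M : Ideal R} (hM : M.IsMaximal) {a b u v : R}
    (haM : M = Ideal.span {a, b}) (huM : M * M = Ideal.span {u, v}) :
    ∃ α β γ : R, (α ∉ M ∨ β ∉ M ∨ γ ∉ M) ∧
      α * a ^ 2 + β * (a * b) + γ * b ^ 2 ∈ M * (M * M) := by
  have ha : a ∈ M := haM ▸ Ideal.subset_span (by simp)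
  have hb : b ∈ M := haM ▸ Ideal.subset_span (by simp)
  have hu : u ∈ M * M := huM ▸ Ideal.subset_span (by simp)
  have hv : v ∈ M * M := huM ▸ Ideal.subset_span (by simp)
  have hrep : ∀ y ∈ M * M, ∃ r s : R, r * u + s * v = y := fun y hy => by
    rw [huM] at hy; exact Ideal.mem_span_pair.1 hy
  obtain ⟨r1, s1, e1⟩ := hrep (a * a) (Ideal.mul_mem_mul ha ha)
  obtain ⟨r2, s2, e2⟩ := hrep (a * b) (Ideal.mul_mem_mul ha hb)
  obtain ⟨r3, s3, e3⟩ := hrep (b * b) (Ideal.mul_mem_mul hb hb)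
  let _ : Field (R ⧸ M) := Ideal.Quotient.field M
  let π := Ideal.Quotient.mk M
  let A : Matrix (Fin 2) (Fin 3) (R ⧸ M) := !![π r1, π r2, π r3; π s1, π s2, π s3]
  have hker := LinearMap.ker_ne_bot_of_finrank_lt (f := A.mulVecLin) (by simp)
  obtain ⟨w, hw, hw0⟩ := (Submodule.ne_bot_iff _).1 hker
  rw [LinearMap.mem_ker, Matrix.mulVecLin_apply] at hw
  obtain ⟨α, hα⟩ := Ideal.Quotient.mk_surjective (I := M) (w 0)
  obtain ⟨β, hβ⟩ := Ideal.Quotient.mk_surjective (I := M) (w 1)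
  obtain ⟨γ, hγ⟩ := Ideal.Quotient.mk_surjective (I := M) (w 2)
  refine ⟨α, β, γ, ?_, ?_⟩
  · by_contra hcon
    push Not at hcon
    apply hw0
    funext i
    fin_cases i
    · simpa [← hα] using Ideal.Quotient.eq_zero_iff_mem.2 hcon.1
    · simpa [← hβ] using Ideal.Quotient.eq_zero_iff_mem.2 hcon.2.1
    · simpa [← hγ] using Ideal.Quotient.eq_zero_iff_mem.2 hcon.2.2
  · have c1 := congrFun hw 0
    have c2 := congrFun hw 1
    simp only [A, Matrix.mulVec, dotProduct, Fin.sum_univ_three, ← hα, ← hβ, ← hγ] at c1 c2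
    simp only [Matrix.of_apply, Matrix.cons_val, π, Pi.zero_apply, ← map_mul, ← map_add] at c1 c2
    have d1 : r1 * α + r2 * β + r3 * γ ∈ M := Ideal.Quotient.eq_zero_iff_mem.1 c1
    have d2 : s1 * α + s2 * β + s3 * γ ∈ M := Ideal.Quotient.eq_zero_iff_mem.1 c2
    have : α * a ^ 2 + β * (a * b) + γ * b ^ 2 =
        (r1 * α + r2 * β + r3 * γ) * u + (s1 * α + s2 * β + s3 * γ) * v := by
      linear_combination (-α) * e1 - β * e2 - γ * e3
    rw [this]
    exact Ideal.add_mem _ (Ideal.mul_mem_mul d1 hu) (Ideal.mul_mem_mul d2 hv)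

theorem sq_reduction {M : Ideal R} (hM : M.IsMaximal) {a b u v : R}
    (haM : M = Ideal.span {a, b}) (huM : M * M = Ideal.span {u, v}) :
    ∃ x ∈ M, M * M ≤ Ideal.span {x} * M ⊔ M * (M * M) := by
  have ha : a ∈ M := haM ▸ Ideal.subset_span (by simp)
  have hb : b ∈ M := haM ▸ Ideal.subset_span (by simp)
  obtain ⟨α, β, γ, hne, hrel⟩ := quad_relation hM haM huM
  have haa := Ideal.mul_mem_mul ha ha
  have hab := Ideal.mul_mem_mul ha hb
  have hbb := Ideal.mul_mem_mul hb hb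
  have hgen : ∀ N : Ideal R, a * a ∈ N → a * b ∈ N → b * b ∈ N → M * M ≤ N := by
    intro N h1 h2 h3
    have : M * M = Ideal.span {a, b} * Ideal.span {a, b} := by rw [← haM]
    rw [this, Ideal.span_mul_span', Ideal.span_le]
    rintro _ ⟨y, (rfl | rfl), z, (rfl | rfl), rfl⟩
    · exact h1
    · exact h2
    · rw [mul_comm] at h2; exact h2
    · exact h3
  have hx : ∀ {x y : R}, y ∈ M → x * y ∈ Ideal.span {x} * M ⊔ M * (M * M) := fun hy =>
    Ideal.mem_sup_left (Ideal.mul_mem_mul (Ideal.mem_span_singleton_self _) hy)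
  by_cases hα : α ∈ M
  · by_cases hγ : γ ∈ M
    · have hβ : β ∉ M := by tauto
      obtain ⟨y, i, hi, hyi⟩ := hM.exists_inv hβ
      refine ⟨a + b, M.add_mem ha hb, ?_⟩
      have h2 : a * b ∈ M * (M * M) := by
        have : a * b = y * (α * a ^ 2 + β * (a * b) + γ * b ^ 2) - (y * (α * (a * a)))
            - (y * (γ * (b * b))) + i * (a * b) := by
          linear_combination (-(a * b)) * hyi
        rw [this]
        refine Ideal.add_mem _ (Ideal.sub_mem _ (Ideal.sub_mem _ ?_ ?_) ?_) ?_
        · exact Ideal.mul_mem_left _ _ hrel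
        · exact Ideal.mul_mem_left _ _ (Ideal.mul_mem_mul hα haa)
        · exact Ideal.mul_mem_left _ _ (Ideal.mul_mem_mul hγ hbb)
        · exact Ideal.mul_mem_mul hi hab
      have h2' := Ideal.mem_sup_right (S := Ideal.span {a + b} * M) h2
      refine hgen _ ?_ h2' ?_
      · have : a * a = (a + b) * a - a * b := by ring
        rw [this]
        exact Ideal.sub_mem _ (hx ha) h2'
      · have : b * b = (a + b) * b - a * b := by ring
        rw [this]
        exact Ideal.sub_mem _ (hx hb) h2'
    · obtain ⟨y, i, hi, hyi⟩ := hM.exists_inv hγ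
      refine ⟨a, ha, hgen _ (hx ha) (hx hb) ?_⟩
      have : b * b = y * (α * a ^ 2 + β * (a * b) + γ * b ^ 2) - (y * α) * (a * a)
            - (y * β) * (a * b) + i * (b * b) := by
          linear_combination (-(b * b)) * hyi
      rw [this]
      refine Ideal.add_mem _ (Ideal.sub_mem _ (Ideal.sub_mem _ ?_ ?_) ?_) ?_
      · exact Ideal.mul_mem_left _ _ (Ideal.mem_sup_right hrel)
      · exact Ideal.mul_mem_left _ _ (hx ha)
      · exact Ideal.mul_mem_left _ _ (hx hb)
      · exact Ideal.mem_sup_right (Ideal.mul_mem_mul hi hbb)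
  · obtain ⟨y, i, hi, hyi⟩ := hM.exists_inv hα
    have hba : a * b ∈ Ideal.span {b} * M ⊔ M * (M * M) := by
      rw [mul_comm a b]; exact hx ha
    refine ⟨b, hb, hgen _ ?_ hba (hx hb)⟩
    have : a * a = y * (α * a ^ 2 + β * (a * b) + γ * b ^ 2) - (y * β) * (b * a)
          - (y * γ) * (b * b) + i * (a * a) := by
        linear_combination (-(a * a)) * hyi
    rw [this]
    refine Ideal.add_mem _ (Ideal.sub_mem _ (Ideal.sub_mem _ ?_ ?_) ?_) ?_
    · exact Ideal.mul_mem_left _ _ (Ideal.mem_sup_right hrel)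
    · exact Ideal.mul_mem_left _ _ (hx ha)
    · exact Ideal.mul_mem_left _ _ (hx hb)
    · exact Ideal.mem_sup_right (Ideal.mul_mem_mul hi haa)

theorem good_of_two_gen (hgen : ∀ I : Ideal R, ∃ a b : R, I = Ideal.span {a, b}) {M : Ideal R}
    (hM : M.IsMaximal) (hM0 : M ≠ ⊥) : GoodSub (coeSubmodule K M) := by
  have hmax := cs_max (K := K) hM
  obtain ⟨a, b, haM⟩ := hgen M
  obtain ⟨u, v, huM⟩ := hgen (M * M)
  obtain ⟨x, hx, hle⟩ := sq_reduction hM haM huM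
  have hle' : coeSubmodule K (M * M) ≤ coeSubmodule K (Ideal.span {x} * M) ⊔
      coeSubmodule K M * coeSubmodule K (M * M) := by
    rw [← coeSubmodule_mul K M, ← coeSubmodule_sup]
    exact coeSubmodule_mono K hle
  have hfg : (coeSubmodule K (M * M)).FG := by
    rw [coeSubmodule_fg K (IsFractionRing.injective R K), huM]
    exact Submodule.fg_span (by simp)
  obtain ⟨s, hs, h1⟩ := sub_nak hfg hle'
  have hs1 : 1 - s ≠ 0 := by
    intro h0
    apply hmax.2.1
    rwa [sub_eq_zero.1 h0]
  have hm0 := cs_ne_bot (K := K) hM0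
  set m := coeSubmodule K M with hmdef
  rw [coeSubmodule_mul, coeSubmodule_mul, coeSubmodule_span_singleton] at h1
  obtain ⟨c, hc, hc0⟩ := (Submodule.ne_bot_iff _).1 hm0
  have hx0 : algebraMap R K x ≠ 0 := by
    intro h0
    have := h1 _ (Submodule.mul_mem_mul hc hc)
    rw [h0, Submodule.span_zero_singleton, Submodule.bot_mul, Submodule.mem_bot] at this
    exact mul_ne_zero hs1 (mul_ne_zero hc0 hc0) this
  have hinv : m * (m / m / m) = m / m := by
    apply inv_of_one_mem
    have hz : (1 - s) * (algebraMap R K x)⁻¹ ∈ m / m / m := by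
      rw [sub_div_div, Submodule.mem_div_iff_forall_mul_mem]
      intro y hy
      obtain ⟨z, hz, hzy⟩ := Submodule.mem_span_singleton_mul.1 (h1 y hy)
      have : (1 - s) * (algebraMap R K x)⁻¹ * y = z := by
        field_simp
        rw [← hzy]
      rw [this]; exact hz
    have h2 : 1 - s ∈ m * (m / m / m) := by
      have : 1 - s = algebraMap R K x * ((1 - s) * (algebraMap R K x)⁻¹) := by field_simp
      rw [this]
      exact Submodule.mul_mem_mul (cs_mem.2 hx) hz
    have h3 : s ∈ m * (m / m / m) := by
      have := Submodule.mul_mem_mul hs (Submodule.one_mem_div.2 (le_endo hmax))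
      simpa using this
    simpa using Submodule.add_mem _ h2 h3
  refine ⟨?_, hinv⟩
  have hcE : Submodule.span R {c} * (m / m) ≤ 1 := by
    refine le_trans ?_ hmax.1
    calc _ ≤ m * (m / m) := mul_le_mul_left (by simpa using hc) _
      _ = m := by rw [mul_comm, endo_mul_self]
  obtain ⟨J, hJ⟩ := exists_cs hcE
  obtain ⟨p, q, hpq⟩ := hgen J
  rw [hpq, coeSubmodule_span, Set.image_pair] at hJ
  refine exchange hmax (u := c⁻¹ * algebraMap R K p) (v := c⁻¹ * algebraMap R K q) ?_
  calc m / m = Submodule.span R {c⁻¹} * (Submodule.span R {c} * (m / m)) := by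
        rw [← mul_assoc, span_inv_mul hc0, one_mul]
    _ = _ := by
      rw [← hJ, Submodule.span_mul_span, Set.singleton_mul, Set.image_pair]

end Good

section FinStable
set_option linter.unusedSectionVars false
variable {R K : Type*} [CommRing R] [IsDomain R] [Field K] [Algebra R K] [IsFractionRing R K]

open IsLocalization

theorem mori_fg (hmori : MoriSub R K) {m : Submodule R K} (hm1 : m ≤ 1) (hm0 : m ≠ ⊥) :
    ∃ F : Submodule R K, F.FG ∧ F ≠ ⊥ ∧ F ≤ m ∧ 1 / F = 1 / m := by
  let X := {J : Submodule R K // J ≤ 1 ∧ J ≠ ⊥ ∧ 1 / (1 / J) = J}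
  have hwf : WellFoundedGT X := by
    rw [wellFoundedGT_iff_monotone_chain_condition]
    intro a
    obtain ⟨n, hn⟩ := hmori (fun k => (a k).1) (fun i j h => a.monotone h) (fun k => (a k).2.1)
      (fun k => (a k).2.2.1) (fun k => (a k).2.2.2)
    exact ⟨n, fun k hk => Subtype.ext (hn k hk).symm⟩
  have hvle : ∀ F : Submodule R K, F ≤ 1 → 1 / (1 / F) ≤ 1 := by
    intro F hF
    have h1 : (1 : Submodule R K) ≤ 1 / F := Submodule.one_le.2 (Submodule.one_mem_div.2 hF)
    have := sub_div_anti (A := 1) h1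
    rwa [sub_div_one] at this
  have hv0 : ∀ F : Submodule R K, F ≠ ⊥ → 1 / (1 / F) ≠ ⊥ := fun F hF h =>
    hF (le_bot_iff.1 (h ▸ sub_le_vclosure F))
  let S : Set X := {J | ∃ F : Submodule R K, F.FG ∧ F ≠ ⊥ ∧ F ≤ m ∧ J.1 = 1 / (1 / F)}
  have hne : S.Nonempty := by
    obtain ⟨c, hc, hc0⟩ := (Submodule.ne_bot_iff _).1 hm0
    have h1 : Submodule.span R {c} ≤ m := by simpa using hc
    have h2 : Submodule.span R {c} ≠ ⊥ := by simpa using hc0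
    exact ⟨⟨1 / (1 / Submodule.span R {c}), hvle _ (h1.trans hm1), hv0 _ h2,
      sub_one_div_vclosure _⟩, _, Submodule.fg_span_singleton c, h2, h1, rfl⟩
  obtain ⟨J, ⟨F, hF, hF0, hFm, hJ⟩, hmax⟩ := hwf.wf.has_min S hne
  refine ⟨F, hF, hF0, hFm, le_antisymm ?_ (sub_div_anti hFm)⟩
  intro z hz
  rw [Submodule.mem_div_iff_forall_mul_mem]
  intro t ht
  have h1 : F ⊔ Submodule.span R {t} ≤ m := sup_le hFm (by simpa using ht)
  have h2 : F ⊔ Submodule.span R {t} ≠ ⊥ := fun h => hF0 (le_bot_iff.1 (h ▸ le_sup_left))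
  let J' : X := ⟨1 / (1 / (F ⊔ Submodule.span R {t})), hvle _ (h1.trans hm1), hv0 _ h2,
      sub_one_div_vclosure _⟩
  have hJ' : J' ∈ S := ⟨_, hF.sup (Submodule.fg_span_singleton t), h2, h1, rfl⟩
  have hle : J.1 ≤ J'.1 := by
    rw [hJ]
    exact sub_div_anti (sub_div_anti le_sup_left)
  have heq : J.1 = J'.1 := by
    by_contra hcon
    exact hmax J' hJ' (lt_of_le_of_ne hle (fun h => hcon (congrArg _ h)))
  have h3 : 1 / F = 1 / (F ⊔ Submodule.span R {t}) := by
    rw [← sub_one_div_vclosure F, ← hJ, heq, sub_one_div_vclosure]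
  rw [h3] at hz
  exact Submodule.mem_div_iff_forall_mul_mem.1 hz t
    (Submodule.mem_sup_right (Submodule.mem_span_singleton_self t))

theorem good_of_finstable (hmori : MoriSub R K) (hsn : SNSub R K)
    (hst : ∀ F : Submodule R K, F.FG → F ≠ ⊥ → F * (F / F / F) = F / F)
    {M : Ideal R} (hM : M.IsMaximal) (hM0 : M ≠ ⊥) : GoodSub (coeSubmodule K M) := by
  have hm := cs_max (K := K) hM
  have hm0 := cs_ne_bot (K := K) hM0
  have hMm : ∀ r : R, algebraMap R K r ∈ coeSubmodule K M ↔ r ∈ M := fun r => cs_mem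
  set m := coeSubmodule K M with hmdef
  rcases max_mul_inv hm with ⟨h1, hE⟩ | ⟨h1, -⟩
  swap
  · exact good_of_inv hm h1
  refine ⟨?_, ?_⟩
  swap
  · obtain ⟨F, hF, hF0, hFm, hF1⟩ := mori_fg hmori hm.1 hm0
    apply inv_of_one_mem
    have h2 : (1 : K) ∈ F * (F / F / F) := (hst F hF hF0).ge (endo_one_mem F)
    refine mul_le_mul' hFm ?_ h2
    calc F / F / F ≤ 1 / F / F := sub_div_mono (sub_div_mono (hFm.trans hm.1))
      _ = 1 / m / F := by rw [hF1]
      _ = 1 / F / m := by rw [sub_div_div, mul_comm, ← sub_div_div]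
      _ = m / m / m := by rw [hF1, hE]
  -- the quadratic generation
  let S := endoAlg m
  have hEm : ∀ {y t : K}, y ∈ m / m → t ∈ m → y * t ∈ m := fun hy ht =>
    Submodule.mem_div_iff_forall_mul_mem.1 hy _ ht
  let nn : Ideal S :=
    { carrier := {y | (y : K) ∈ m}
      add_mem' := fun ha hb => m.add_mem ha hb
      zero_mem' := m.zero_mem
      smul_mem' := fun c y hy => hEm c.2 hy }
  have hnn : ∀ y : S, y ∈ nn ↔ (y : K) ∈ m := fun y => Iff.rfl
  let _ : Field (R ⧸ M) := Ideal.Quotient.field M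
  let f : R ⧸ M →+* S ⧸ nn := Ideal.quotientMap nn (algebraMap R S) (by
    intro r hr
    exact (hMm r).2 hr)
  let _ : Algebra (R ⧸ M) (S ⧸ nn) := f.toAlgebra
  have hf : ∀ r : R, algebraMap (R ⧸ M) (S ⧸ nn) (Ideal.Quotient.mk M r) =
      Ideal.Quotient.mk nn (algebraMap R S r) := fun r => rfl
  have hmk : ∀ y z : S, Ideal.Quotient.mk nn y = Ideal.Quotient.mk nn z ↔ (y : K) - z ∈ m :=
    fun y z => Ideal.Quotient.eq
  have hnt : Nontrivial (S ⧸ nn) := by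
    rw [Ideal.Quotient.nontrivial_iff, Ideal.ne_top_iff_one]
    exact hm.2.1
  have hred : IsReduced (S ⧸ nn) := by
    rw [isReduced_iff_pow_one_lt 2 one_lt_two]
    intro y hy
    obtain ⟨y, rfl⟩ := Ideal.Quotient.mk_surjective y
    rw [← map_pow, Ideal.Quotient.eq_zero_iff_mem] at hy
    rw [Ideal.Quotient.eq_zero_iff_mem]
    exact endo_reduced hsn hm y.2 hy
  obtain ⟨x, hx⟩ := algebra_quadratic (k := R ⧸ M) (A := S ⧸ nn) (by
    intro u v w hpqr hb
    obtain ⟨p, q, r, hpqr⟩ := hpqr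
    obtain ⟨u, rfl⟩ := Ideal.Quotient.mk_surjective u
    obtain ⟨v, rfl⟩ := Ideal.Quotient.mk_surjective v
    obtain ⟨w, rfl⟩ := Ideal.Quotient.mk_surjective w
    obtain ⟨p, rfl⟩ := Ideal.Quotient.mk_surjective p
    obtain ⟨q, rfl⟩ := Ideal.Quotient.mk_surjective q
    obtain ⟨r, rfl⟩ := Ideal.Quotient.mk_surjective r
    have hm0' : (1 : K) - (p * u + q * v + r * w) ∈ m :=
      (hmk 1 (p * u + q * v + r * w)).1 (by simpa using hpqr.symm)
    set m0 : K := (1 : K) - (p * u + q * v + r * w) with hm0def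
    let I : Submodule R K := Submodule.span R {(u : K), (v : K), (w : K), m0}
    have huI : (u : K) ∈ I := Submodule.subset_span (by simp)
    have hvI : (v : K) ∈ I := Submodule.subset_span (by simp)
    have hwI : (w : K) ∈ I := Submodule.subset_span (by simp)
    have hmI0 : m0 ∈ I := Submodule.subset_span (by simp)
    have hIE : I ≤ m / m := by
      rw [Submodule.span_le]
      rintro y (rfl | rfl | rfl | rfl)
      · exact u.2
      · exact v.2
      · exact w.2
      · exact le_endo hm hm0'
    have h1EI : (1 : K) ∈ m / m * I := by
      have : (1 : K) = p * u + q * v + r * w + 1 * m0 := by rw [hm0def]; ring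
      rw [this]
      exact Submodule.add_mem _ (Submodule.add_mem _ (Submodule.add_mem _
        (Submodule.mul_mem_mul p.2 huI) (Submodule.mul_mem_mul q.2 hvI))
        (Submodule.mul_mem_mul r.2 hwI)) (Submodule.mul_mem_mul (endo_one_mem m) hmI0)
    have hI0 : I ≠ ⊥ := by
      intro h
      rw [h, Submodule.mul_bot, Submodule.mem_bot] at h1EI
      exact one_ne_zero h1EI
    have hmI : m ≤ I := by
      calc m = m * 1 := (mul_one m).symm
        _ ≤ m * (m / m * I) := mul_le_mul_right (Submodule.one_le.2 h1EI) m
        _ = m * I := by rw [← mul_assoc, mul_comm m, endo_mul_self]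
        _ ≤ 1 * I := mul_le_mul_left hm.1 I
        _ = I := one_mul I
    have hII : I / I = 1 := by
      refine le_antisymm ?_ (endo_one_le I)
      intro b hbI
      have hbE : b ∈ m / m := by
        have h2 : b * 1 ∈ I / I * (m / m * I) := Submodule.mul_mem_mul hbI h1EI
        rw [mul_one] at h2
        have h3 : I / I * (m / m * I) ≤ m / m := by
          calc I / I * (m / m * I) = m / m * (I / I * I) := by ring
            _ ≤ m / m * (m / m) := by
              rw [endo_mul_self]; exact mul_le_mul_right hIE _
            _ = m / m := endo_mul_endo m
        exact h3 h2
      have hrep : ∀ y : S, (y : K) ∈ I → ∃ c₁ c₂ c₃ : R ⧸ M,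
          Ideal.Quotient.mk nn y = algebraMap (R ⧸ M) (S ⧸ nn) c₁ * Ideal.Quotient.mk nn u +
            algebraMap (R ⧸ M) (S ⧸ nn) c₂ * Ideal.Quotient.mk nn v +
            algebraMap (R ⧸ M) (S ⧸ nn) c₃ * Ideal.Quotient.mk nn w := by
        intro y hy
        obtain ⟨c₁, z₁, hz₁, e₁⟩ := Submodule.mem_span_insert.1 hy
        obtain ⟨c₂, z₂, hz₂, e₂⟩ := Submodule.mem_span_insert.1 hz₁
        obtain ⟨c₃, z₃, hz₃, e₃⟩ := Submodule.mem_span_insert.1 hz₂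
        obtain ⟨c₄, e₄⟩ := Submodule.mem_span_singleton.1 hz₃
        refine ⟨Ideal.Quotient.mk M c₁, Ideal.Quotient.mk M c₂, Ideal.Quotient.mk M c₃, ?_⟩
        rw [hf, hf, hf, ← map_mul, ← map_mul, ← map_mul, ← map_add, ← map_add, hmk]
        have : (y : K) - ((algebraMap R S c₁ * u + algebraMap R S c₂ * v + algebraMap R S c₃ * w : S) : K)
            = c₄ • m0 := by
          rw [e₁, e₂, e₃, ← e₄]
          simp only [Algebra.smul_def]
          push_cast
          ring
        rw [this]
        exact m.smul_mem _ hm0'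
      obtain ⟨c, hc⟩ := hb (Ideal.Quotient.mk nn ⟨b, hbE⟩) (by
        intro y hy
        have hbI' := Submodule.mem_div_iff_forall_mul_mem.1 hbI
        simp only [List.mem_cons, List.not_mem_nil, or_false] at hy
        rcases hy with rfl | rfl | rfl
        · rw [← map_mul]; exact hrep _ (hbI' _ huI)
        · rw [← map_mul]; exact hrep _ (hbI' _ hvI)
        · rw [← map_mul]; exact hrep _ (hbI' _ hwI))
      obtain ⟨c, rfl⟩ := Ideal.Quotient.mk_surjective c
      rw [hf, hmk] at hc
      have : b = (b - algebraMap R K c) + algebraMap R K c := by ring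
      rw [this]
      exact Submodule.add_mem _ (hm.1 hc) (Submodule.mem_one.2 ⟨c, rfl⟩)
    have hIfg : I.FG := Submodule.fg_span (Set.toFinite _)
    have hinv := hst I hIfg hI0
    rw [hII] at hinv
    have hex : ∃ a ∈ I, ∃ g ∈ 1 / I, a * g ∉ m := by
      by_contra hcon
      push Not at hcon
      have : I * (1 / I) ≤ m := Submodule.mul_le.2 hcon
      rw [hinv] at this
      exact hm.2.1 (Submodule.one_le.1 this)
    obtain ⟨a, ha, g, hg, hag⟩ := hex
    have hg' := Submodule.mem_div_iff_forall_mul_mem.1 hg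
    obtain ⟨r', hr', hr1⟩ := hm.2.2 (a * g) (by rw [mul_comm]; exact hg' a ha) hag
    refine ⟨Ideal.Quotient.mk nn ⟨a, hIE ha⟩, ?_⟩
    have hfin : ∀ y : S, (y : K) ∈ I → ∃ c : R ⧸ M, Ideal.Quotient.mk nn y =
        algebraMap (R ⧸ M) (S ⧸ nn) c * Ideal.Quotient.mk nn ⟨a, hIE ha⟩ := by
      intro y hy
      obtain ⟨c, hc⟩ := Submodule.mem_one.1 (sub_one_mul_mem hr' (hg' y hy))
      refine ⟨Ideal.Quotient.mk M c, ?_⟩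
      rw [hf, ← map_mul, hmk]
      have : (y : K) - ((algebraMap R S c * ⟨a, hIE ha⟩ : S) : K) = y * (1 - r' * (a * g)) := by
        push_cast
        rw [hc]
        ring
      rw [this]
      exact hEm y.2 hr1
    intro y hy
    simp only [List.mem_cons, List.not_mem_nil, or_false] at hy
    rcases hy with rfl | rfl | rfl
    · exact hfin _ huI
    · exact hfin _ hvI
    · exact hfin _ hwI)
  obtain ⟨x, rfl⟩ := Ideal.Quotient.mk_surjective x
  refine ⟨x, le_antisymm ?_ ?_⟩
  · intro y hy
    obtain ⟨c, d, hcd⟩ := hx (Ideal.Quotient.mk nn ⟨y, hy⟩)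
    obtain ⟨c, rfl⟩ := Ideal.Quotient.mk_surjective c
    obtain ⟨d, rfl⟩ := Ideal.Quotient.mk_surjective d
    rw [hf, hf, ← map_mul, ← map_add, hmk] at hcd
    obtain ⟨t, ht⟩ := Submodule.mem_one.1 (hm.1 hcd)
    refine Submodule.mem_span_pair.2 ⟨t + c, d, ?_⟩
    push_cast at ht
    rw [Algebra.smul_def, Algebra.smul_def, map_add, ht]
    ring
  · rw [Submodule.span_le]
    rintro y (rfl | rfl)
    · exact endo_one_mem m
    · exact x.2

end FinStable

section Transl
variable {R : Type*} [CommRing R] [IsDomain R]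

open IsLocalization

theorem coe_frac_ne_zero {I : Ideal R} (hI : I ≠ ⊥) :
    (I : FractionalIdeal R⁰ (FractionRing R)) ≠ 0 :=
  FractionalIdeal.coeIdeal_ne_zero.2 hI

theorem divisorial_iff {I : Ideal R} (hI : I ≠ ⊥) : I.IsDivisorial ↔
    1 / (1 / coeSubmodule (FractionRing R) I) = coeSubmodule (FractionRing R) I := by
  have h0 := coe_frac_ne_zero hI
  have h1 : (1 : FractionalIdeal R⁰ (FractionRing R)) / I ≠ 0 := by
    intro h
    have h2 : (1 : FractionalIdeal R⁰ (FractionRing R)) ≤ 1 / I := by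
      rw [FractionalIdeal.le_div_iff_mul_le h0, one_mul]
      exact FractionalIdeal.coeIdeal_le_one
    rw [h] at h2
    exact one_ne_zero (le_antisymm h2 (FractionalIdeal.zero_le 1))
  rw [Ideal.IsDivisorial, ← FractionalIdeal.coeToSubmodule_inj, FractionalIdeal.coe_div h1,
    FractionalIdeal.coe_div h0, FractionalIdeal.coe_one]
  rfl

theorem stable_iff {I : Ideal R} (hI : I ≠ ⊥) : I.IsStableIdeal ↔
    coeSubmodule (FractionRing R) I * (coeSubmodule (FractionRing R) I /
      coeSubmodule (FractionRing R) I / coeSubmodule (FractionRing R) I) =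
      coeSubmodule (FractionRing R) I / coeSubmodule (FractionRing R) I := by
  have h0 := coe_frac_ne_zero hI
  rw [Ideal.IsStableIdeal, ← FractionalIdeal.coeToSubmodule_inj, FractionalIdeal.coe_mul,
    FractionalIdeal.coe_div h0, FractionalIdeal.coe_div h0]
  rfl

theorem bot_divisorial : (⊥ : Ideal R).IsDivisorial := by
  simp [Ideal.IsDivisorial]

theorem sn_sub (h : SeminormalRing R) : SNSub R (FractionRing R) := by
  intro x h2 h3
  exact Submodule.mem_one.2 (h x (Submodule.mem_one.1 h2) (Submodule.mem_one.1 h3))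

theorem mori_sub (h : MoriRing R) : MoriSub R (FractionRing R) := by
  intro g hg hg1 hg0 hgv
  choose f hf using fun n => exists_cs (hg1 n)
  have hmono : Monotone f := by
    intro i j hij
    rw [← IsFractionRing.coeSubmodule_le_coeSubmodule (K := FractionRing R), hf, hf]
    exact hg hij
  obtain ⟨n, hn⟩ := h ⟨f, hmono⟩ (fun n => by
    have h0 : f n ≠ ⊥ := by
      intro h
      apply hg0 n
      rw [← hf, h, coeSubmodule_bot]
    refine (divisorial_iff h0).2 ?_
    rw [hf, hgv])
  refine ⟨n, fun k hk => ?_⟩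
  rw [← hf k, ← hf n]
  exact congrArg _ (hn k hk)

theorem mori_of_noeth [IsNoetherianRing R] : MoriRing R := by
  intro f _
  obtain ⟨n, hn⟩ := monotone_stabilizes_iff_noetherian.2 (inferInstanceAs (IsNoetherian R R)) f
  exact ⟨n, fun k hk => (hn k hk).symm⟩

theorem noeth_of_div_mori (hd : DivisorialRing R) (h : MoriRing R) : IsNoetherianRing R := by
  refine monotone_stabilizes_iff_noetherian.1 fun f => ?_
  obtain ⟨n, hn⟩ := h f (fun n => by
    by_cases h0 : f n = ⊥
    · rw [h0]; exact bot_divisorial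
    · exact hd _ h0)
  exact ⟨n, fun k hk => (hn k hk).symm⟩

theorem span_mul_div {K : Type*} [Field K] [Algebra R K] {p : K} (hp : p ≠ 0)
    (A D : Submodule R K) :
    (Submodule.span R {p} * A) / D = Submodule.span R {p} * (A / D) := by
  have h := span_inv_mul (R := R) hp
  apply le_antisymm
  · calc (Submodule.span R {p} * A) / D
        = Submodule.span R {p} * (Submodule.span R {p⁻¹} * ((Submodule.span R {p} * A) / D)) := by
          rw [← mul_assoc, mul_comm (Submodule.span R {p}) (Submodule.span R {p⁻¹}), h, one_mul]
      _ ≤ _ := by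
          refine mul_le_mul_right ?_ _
          rw [Submodule.le_div_iff_mul_le, mul_assoc]
          calc _ ≤ Submodule.span R {p⁻¹} * (Submodule.span R {p} * A) :=
                mul_le_mul_right (sub_div_mul_le _ _) _
            _ = A := by rw [← mul_assoc, h, one_mul]
  · rw [Submodule.le_div_iff_mul_le, mul_assoc]
    exact mul_le_mul_right (sub_div_mul_le _ _) _

theorem div_span_mul {K : Type*} [Field K] [Algebra R K] {p : K} (hp : p ≠ 0)
    (A D : Submodule R K) :
    A / (Submodule.span R {p} * D) = Submodule.span R {p⁻¹} * (A / D) := by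
  rw [span_mul_one_div (inv_ne_zero hp), inv_inv]

theorem scaled_ne_bot {K : Type*} [Field K] [Algebra R K] {p : K} (hp : p ≠ 0)
    {J : Submodule R K} (hJ : J ≠ ⊥) : Submodule.span R {p} * J ≠ ⊥ := by
  intro h
  apply hJ
  rw [← one_mul J, ← span_inv_mul (R := R) hp, mul_assoc, h, Submodule.mul_bot]

theorem div_sub (hd : DivisorialRing R) (J : Submodule R (FractionRing R)) (hJ : J ≠ ⊥)
    (hc : ∃ c : FractionRing R, c ≠ 0 ∧ ∀ y ∈ J, c * y ∈ (1 : Submodule R (FractionRing R))) :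
    1 / (1 / J) = J := by
  obtain ⟨c, hc0, hc⟩ := hc
  have hle : Submodule.span R {c} * J ≤ 1 := by
    intro z hz
    obtain ⟨y, hy, rfl⟩ := Submodule.mem_span_singleton_mul.1 hz
    exact hc y hy
  obtain ⟨I, hI⟩ := exists_cs hle
  have hI0 : I ≠ ⊥ := by
    intro h
    rw [h, coeSubmodule_bot] at hI
    exact scaled_ne_bot hc0 hJ hI.symm
  have h1 := (divisorial_iff hI0).1 (hd I hI0)
  rw [hI, div_span_mul hc0, div_span_mul (inv_ne_zero hc0), inv_inv] at h1
  have h2 := congrArg (fun X => Submodule.span R {c⁻¹} * X) h1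
  simpa only [← mul_assoc, span_inv_mul hc0, one_mul] using h2

theorem stab_sub (hs : FinitelyStableRing R) (F : Submodule R (FractionRing R)) (hF : F.FG)
    (hF0 : F ≠ ⊥) : F * (F / F / F) = F / F := by
  obtain ⟨a, ha, hFa⟩ := FractionalIdeal.isFractional_of_fg (S := R⁰) hF
  have hc0 : algebraMap R (FractionRing R) a ≠ 0 :=
    IsFractionRing.to_map_ne_zero_of_mem_nonZeroDivisors ha
  set c := algebraMap R (FractionRing R) a with hcdef
  have hle : Submodule.span R {c} * F ≤ 1 := by
    intro z hz
    obtain ⟨y, hy, rfl⟩ := Submodule.mem_span_singleton_mul.1 hz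
    obtain ⟨r, hr⟩ := hFa y hy
    refine Submodule.mem_one.2 ⟨r, ?_⟩
    rw [hr, Algebra.smul_def]
  obtain ⟨I, hI⟩ := exists_cs hle
  have hI0 : I ≠ ⊥ := by
    intro h
    rw [h, coeSubmodule_bot] at hI
    exact scaled_ne_bot hc0 hF0 hI.symm
  have hIfg : I.FG := by
    refine (coeSubmodule_fg (FractionRing R) (IsFractionRing.injective R _) I).1 ?_
    rw [hI]
    exact (Submodule.fg_span_singleton c).mul hF
  have h1 := (stable_iff hI0).1 (hs I hI0 hIfg)
  have h2 : (Submodule.span R {c} * F) / (Submodule.span R {c} * F) = F / F := by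
    rw [span_mul_div hc0, div_span_mul hc0, ← mul_assoc, mul_comm (Submodule.span R {c}),
      span_inv_mul hc0, one_mul]
  rw [hI, h2, div_span_mul hc0] at h1
  calc F * (F / F / F) = (Submodule.span R {c⁻¹} * Submodule.span R {c}) * (F * (F / F / F)) := by
        rw [span_inv_mul hc0, one_mul]
    _ = Submodule.span R {c} * F * (Submodule.span R {c⁻¹} * (F / F / F)) := by ring
    _ = F / F := h1

theorem core_of_two_gen (hsn : SeminormalRing R) (h : ∀ I : Ideal R, I.TwoGenerated) :
    CoreSub R (FractionRing R) := by
  have : IsNoetherianRing R := by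
    refine ⟨fun I => ?_⟩
    obtain ⟨a, b, rfl⟩ := h I
    exact Submodule.fg_span (by simp)
  exact ⟨sn_sub hsn, mori_sub mori_of_noeth, fun M hM hM0 => good_of_two_gen h hM hM0⟩

theorem core_of_div (hsn : SeminormalRing R) (h : DivisorialRing R ∧ MoriRing R) :
    CoreSub R (FractionRing R) := by
  have := noeth_of_div_mori h.1 h.2
  exact ⟨sn_sub hsn, mori_sub h.2, fun M hM hM0 =>
    good_of_divisorial (sn_sub hsn) (cs_max hM) (cs_ne_bot hM0) (div_sub h.1)⟩

theorem core_of_stab (hsn : SeminormalRing R) (h : FinitelyStableRing R ∧ MoriRing R) :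
    CoreSub R (FractionRing R) :=
  ⟨sn_sub hsn, mori_sub h.2, fun M hM hM0 =>
    good_of_finstable (mori_sub h.2) (sn_sub hsn) (stab_sub h.1) hM hM0⟩

theorem two_gen_of_core (h : CoreSub R (FractionRing R)) (I : Ideal R) : I.TwoGenerated := by
  have := core_noeth h
  by_cases hI : I = ⊥
  · exact ⟨0, 0, by simp [hI]⟩
  · exact two_gen_of_local (fun P hP hP0 => core_prime_max h hP hP0)
      (fun M hM => core_local_gen h hI hM)

theorem div_of_core (h : CoreSub R (FractionRing R)) : DivisorialRing R ∧ MoriRing R := by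
  have := core_noeth h
  exact ⟨fun I hI => (divisorial_iff hI).2 (core_divisorial h (cs_ne_bot hI) (cs_le_one I)),
    mori_of_noeth⟩

theorem stab_of_core (h : CoreSub R (FractionRing R)) : FinitelyStableRing R ∧ MoriRing R := by
  have := core_noeth h
  exact ⟨fun I hI _ => (stable_iff hI).2 (core_stable h (cs_ne_bot hI) (cs_le_one I)),
    mori_of_noeth⟩

end Transl

theorem seminormal_two_generated_tfae (R : Type*) [CommRing R] [IsDomain R]
    (hsn : SeminormalRing R) :
    ((∀ I : Ideal R, I.TwoGenerated) ↔ (DivisorialRing R ∧ MoriRing R)) ∧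
    ((DivisorialRing R ∧ MoriRing R) ↔ (FinitelyStableRing R ∧ MoriRing R)) := by
  exact ⟨⟨fun h => div_of_core (core_of_two_gen hsn h), fun h => two_gen_of_core (core_of_div hsn h)⟩,
      ⟨fun h => stab_of_core (core_of_div hsn h), fun h => div_of_core (core_of_stab hsn h)⟩⟩
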